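/- arXiv:math/9407215 — 2 statements merged into one kernel-verified Lean document; each statement's English description precedes it below -/
import Mathlib

section
/- Let p ≥ 3 be an integer, and let T be an invertible contraction on a Banach space whose spectrum Sp T is contained in the perfect symmetric set E_{1/p} ⊆ Γ of constant ratio 1/p, with limsup_{n→∞} (log⁺‖T^{−n}‖)/n^α < +∞ for some α < (log p − log 2)/(2 log p − log 2). If in addition Sp T is a Dirichlet set, then T is an invertible isometry. -/
noncomputable section

/-- An invertible contraction on a (complex) Banach space. -/
structure BanachContraction where
  X : Type
  [grp : NormedAddCommGroup X]
  [mod : NormedSpace ℂ X]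
  [cpl : CompleteSpace X]
  T : X →L[ℂ] X
  Tinv : X →L[ℂ] X
  norm_le : ‖T‖ ≤ 1
  mul_inv : T * Tinv = 1
  inv_mul : Tinv * T = 1

attribute [instance] BanachContraction.grp BanachContraction.mod BanachContraction.cpl

open Complex MeasureTheory Metric Set Filter

/-- The `n`-th Taylor coefficient of `f` at `0`, i.e. `f⁽ⁿ⁾(0)/n!`. -/
def taylorCoeff (f : ℂ → ℂ) (n : ℕ) : ℂ := iteratedDeriv n f 0 / (n.factorial : ℂ)

/-- `A⁺`, the algebra of absolutely convergent Taylor series: functions which, on the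
closed unit disk, are sums of a power series with absolutely summable coefficients. -/
def APlus : Set (ℂ → ℂ) :=
  {f | ∃ a : ℕ → ℂ, Summable (fun n => ‖a n‖) ∧
    ∀ z ∈ Metric.closedBall (0 : ℂ) 1, HasSum (fun n => a n * z ^ n) (f z)}

/-- The norm `‖f‖₁ = ∑ₙ |f⁽ⁿ⁾(0)/n!|` on `A⁺`. -/
def APlusNorm (f : ℂ → ℂ) : ℝ := ∑' n : ℕ, ‖taylorCoeff f n‖

/-- The `n`-th Fourier coefficient of (the boundary values of) `f` on the unit circle. -/
def fcoeff (f : ℂ → ℂ) (n : ℤ) : ℂ :=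
  (1 / (2 * Real.pi)) * ∫ θ in (0:ℝ)..(2 * Real.pi),
    f (Complex.exp ((θ : ℂ) * Complex.I)) * Complex.exp (-(n : ℂ) * (θ : ℂ) * Complex.I)

/-- The Wiener algebra `A(Γ)` of absolutely convergent Fourier series on the unit circle,
viewed as functions `ℂ → ℂ` (only the values on the unit circle are relevant). -/
def WienerAlg : Set (ℂ → ℂ) :=
  {f | Summable (fun n : ℤ => ‖fcoeff f n‖) ∧
    ∀ z ∈ Metric.sphere (0 : ℂ) 1, HasSum (fun n : ℤ => fcoeff f n * z ^ n) (f z)}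

/-- The norm `‖f‖₁ = ∑_{n ∈ ℤ} |f̂(n)|` on `A(Γ)`. -/
def WienerNorm (f : ℂ → ℂ) : ℝ := ∑' n : ℤ, ‖fcoeff f n‖

/-- `I` is a closed ideal of `A⁺` (closedness w.r.t. the norm `APlusNorm`). -/
def IsClosedIdealAPlus (I : Set (ℂ → ℂ)) : Prop :=
  I ⊆ APlus ∧
  (∀ f ∈ I, ∀ g ∈ I, f + g ∈ I) ∧
  (∀ f ∈ APlus, ∀ g ∈ I, f * g ∈ I) ∧
  (∀ f ∈ APlus, (∀ ε > 0, ∃ g ∈ I, APlusNorm (f - g) < ε) → f ∈ I)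

/-- `J` is a closed ideal of the Wiener algebra `A(Γ)`. -/
def IsClosedIdealW (J : Set (ℂ → ℂ)) : Prop :=
  J ⊆ WienerAlg ∧
  (∀ f ∈ J, ∀ g ∈ J, f + g ∈ J) ∧
  (∀ f ∈ WienerAlg, ∀ g ∈ J, f * g ∈ J) ∧
  (∀ f ∈ WienerAlg, (∀ ε > 0, ∃ g ∈ J, WienerNorm (f - g) < ε) → f ∈ J)

/-- `I^A` : the closed ideal generated by `I` in the Wiener algebra `A(Γ)`. -/
def IdealGenW (I : Set (ℂ → ℂ)) : Set (ℂ → ℂ) := ⋂₀ {J | IsClosedIdealW J ∧ I ⊆ J}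

/-- The hull `h(I)`: common zeros in the closed unit disk of all elements of `I`. -/
def hull (I : Set (ℂ → ℂ)) : Set ℂ :=
  {z ∈ Metric.closedBall (0 : ℂ) 1 | ∀ f ∈ I, f z = 0}

/-- `I ≠ {0}`: `I` contains an element not identically zero on the unit disk. -/
def NontrivialIdeal (I : Set (ℂ → ℂ)) : Prop :=
  ∃ f ∈ I, ∃ z ∈ Metric.ball (0 : ℂ) 1, f z ≠ 0

/-- `H^∞(D)`: bounded holomorphic functions on the open unit disk. -/
def Hinf : Set (ℂ → ℂ) :=
  {f | DifferentiableOn ℂ f (Metric.ball (0 : ℂ) 1) ∧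
    ∃ C : ℝ, ∀ z ∈ Metric.ball (0 : ℂ) 1, ‖f z‖ ≤ C}

/-- An inner function: a bounded-by-one holomorphic function on the unit disk whose
radial limits have modulus `1` at almost every boundary point. -/
def IsInnerFunction (u : ℂ → ℂ) : Prop :=
  DifferentiableOn ℂ u (Metric.ball (0 : ℂ) 1) ∧
  (∀ z ∈ Metric.ball (0 : ℂ) 1, ‖u z‖ ≤ 1) ∧
  ∀ᵐ (θ : ℝ) ∂(MeasureTheory.volume.restrict (Set.Ioc (0 : ℝ) (2 * Real.pi))),
    Filter.Tendsto (fun r : ℝ => ‖u ((r : ℂ) * Complex.exp ((θ : ℂ) * Complex.I))‖)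
      (nhdsWithin 1 (Set.Iio 1)) (nhds 1)

/-- `S` divides (the inner factor of) `f`, i.e. `f ∈ S·H^∞`. -/
def InnerDivides (S f : ℂ → ℂ) : Prop :=
  ∃ g ∈ Hinf, ∀ z ∈ Metric.ball (0 : ℂ) 1, f z = S z * g z

/-- `S` is a greatest common divisor of the inner factors of the nonzero elements of `I`:
`S` is inner, divides every nonzero element of `I`, and every inner function with this
property divides `S`. -/
def IsGcdInner (I : Set (ℂ → ℂ)) (S : ℂ → ℂ) : Prop :=
  IsInnerFunction S ∧
  (∀ f ∈ I, (∃ z ∈ Metric.ball (0 : ℂ) 1, f z ≠ 0) → InnerDivides S f) ∧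
  ∀ S' : ℂ → ℂ, IsInnerFunction S' →
    (∀ f ∈ I, (∃ z ∈ Metric.ball (0 : ℂ) 1, f z ≠ 0) → InnerDivides S' f) →
    InnerDivides S' S

/-- The perfect symmetric set `E_ξ` of constant ratio `ξ` on the unit circle. -/
def Eset (ξ : ℝ) : Set ℂ :=
  {z | ∃ ε : ℕ → ℕ, (∀ k, ε k ≤ 1) ∧
    z = Complex.exp (2 * Real.pi * Complex.I *
      (((1 - ξ) * ∑' k : ℕ, (ε k : ℝ) * ξ ^ k : ℝ) : ℂ))}

/-- A Carleson set: a closed subset of the unit circle with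
`∫_{-π}^{π} log (2 / dist(e^{iθ}, E)) dθ < ∞`. -/
def IsCarleson (E : Set ℂ) : Prop :=
  IsClosed E ∧ E ⊆ Metric.sphere (0 : ℂ) 1 ∧
  MeasureTheory.IntegrableOn
    (fun θ : ℝ => Real.log (2 / Metric.infDist (Complex.exp ((θ : ℂ) * Complex.I)) E))
    (Set.Ioc (-Real.pi) Real.pi)

/-- The division ideal `I(f) = {g ∈ A⁺ : fg ∈ I}`. -/
def Idiv (I : Set (ℂ → ℂ)) (f : ℂ → ℂ) : Set (ℂ → ℂ) := {g ∈ APlus | f * g ∈ I}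

/-- `f` belongs to `A^∞(D)` and vanishes on `E` together with all its derivatives:
`f` is holomorphic on the disk, and each derivative extends continuously to the closed
disk with the extension vanishing on `E`. -/
def VanishAllDeriv (E : Set ℂ) (f : ℂ → ℂ) : Prop :=
  ContinuousOn f (Metric.closedBall (0 : ℂ) 1) ∧
  DifferentiableOn ℂ f (Metric.ball (0 : ℂ) 1) ∧
  (∀ z ∈ E, f z = 0) ∧
  ∀ n : ℕ, ∃ g : ℂ → ℂ, ContinuousOn g (Metric.closedBall (0 : ℂ) 1) ∧
    Set.EqOn g (iteratedDeriv n f) (Metric.ball (0 : ℂ) 1) ∧ ∀ z ∈ E, g z = 0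

/-- `J₀⁺(E)`: the closure in `A⁺` of the set of elements of `A^∞(D)` vanishing on `E`
together with all their derivatives. -/
def J0Plus (E : Set ℂ) : Set (ℂ → ℂ) :=
  {f | f ∈ APlus ∧ ∀ ε > 0, ∃ g ∈ APlus, VanishAllDeriv E g ∧ APlusNorm (f - g) < ε}

/-- `I⁺(E) = {f ∈ A⁺ : f ≡ 0 on E}`. -/
def IPlus (E : Set ℂ) : Set (ℂ → ℂ) := {f ∈ APlus | ∀ z ∈ E, f z = 0}

/-- The pairing of `f ∈ A⁺ ≅ ℓ¹(ℕ)` with an element `c ∈ c₀`. -/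
def pairing (f : ℂ → ℂ) (c : ℕ → ℂ) : ℂ := ∑' n : ℕ, taylorCoeff f n * c n

/-- `S` is dense in `A⁺` for the weak-star topology `σ(ℓ¹, c₀)`. -/
def WStarDense (S : Set (ℂ → ℂ)) : Prop :=
  ∀ f ∈ APlus, ∀ (m : ℕ) (c : Fin m → ℕ → ℂ),
    (∀ i, Filter.Tendsto (c i) Filter.atTop (nhds 0)) →
    ∀ ε > 0, ∃ g ∈ S, ∀ i, ‖pairing f (c i) - pairing g (c i)‖ < ε

/-- `S` is closed in `A⁺` for the weak-star topology `σ(ℓ¹, c₀)`. -/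
def WStarClosed (S : Set (ℂ → ℂ)) : Prop :=
  S ⊆ APlus ∧
  ∀ f ∈ APlus,
    (∀ (m : ℕ) (c : Fin m → ℕ → ℂ),
      (∀ i, Filter.Tendsto (c i) Filter.atTop (nhds 0)) →
      ∀ ε > 0, ∃ g ∈ S, ∀ i, ‖pairing f (c i) - pairing g (c i)‖ < ε) → f ∈ S

/-- A Kronecker set: a compact subset of the unit circle on which every continuous
unimodular function is a uniform limit of characters `z ↦ zⁿ`, `n ∈ ℤ`. -/
def IsKronecker (K : Set ℂ) : Prop :=
  IsCompact K ∧ K ⊆ Metric.sphere (0 : ℂ) 1 ∧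
  ∀ f : ℂ → ℂ, ContinuousOn f K → (∀ z ∈ K, ‖f z‖ = 1) →
    ∀ ε > 0, ∃ n : ℤ, ∀ z ∈ K, ‖f z - z ^ n‖ < ε

/-- A Helson set: a compact subset of the unit circle on which every continuous function
is the restriction of an element of the Wiener algebra. -/
def IsHelson (K : Set ℂ) : Prop :=
  IsCompact K ∧ K ⊆ Metric.sphere (0 : ℂ) 1 ∧
  ∀ f : ℂ → ℂ, ContinuousOn f K → ∃ g ∈ WienerAlg, ∀ z ∈ K, f z = g z

/-- The little Lipschitz class `Λ_α(D)`: disc-algebra functions with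
`|f(e^{it₁}) - f(e^{it₂})| / |t₁-t₂|^α → 0` uniformly as `|t₁-t₂| → 0`. -/
def LittleLip (α : ℝ) (f : ℂ → ℂ) : Prop :=
  ContinuousOn f (Metric.closedBall (0 : ℂ) 1) ∧
  DifferentiableOn ℂ f (Metric.ball (0 : ℂ) 1) ∧
  ∀ ε > 0, ∃ δ > 0, ∀ t₁ t₂ : ℝ, t₁ ≠ t₂ → |t₁ - t₂| < δ →
    ‖f (Complex.exp ((t₁ : ℂ) * Complex.I)) - f (Complex.exp ((t₂ : ℂ) * Complex.I))‖ ≤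
      ε * |t₁ - t₂| ^ α

/-- The perfect part of a set: the union of all its perfect subsets. -/
def perfectPart (C : Set ℂ) : Set ℂ := ⋃₀ {P | Perfect P ∧ P ⊆ C}

/-- A distribution on the unit circle, encoded by its sequence of Fourier coefficients
`μ̂(n) = μ(e^{-int})`, which has polynomial growth. -/
structure CircleDistribution where
  coeff : ℤ → ℂ
  growth : ∃ (C : ℝ) (k : ℕ), ∀ n : ℤ, ‖coeff n‖ ≤ C * (1 + (n.natAbs : ℝ)) ^ k

/-- A smooth `2π`-periodic function (test function on the circle). -/
def PeriodicSmooth (φ : ℝ → ℂ) : Prop :=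
  ContDiff ℝ (⊤ : ℕ∞) φ ∧ ∀ θ : ℝ, φ (θ + 2 * Real.pi) = φ θ

/-- Fourier coefficients of a test function. -/
def testCoeff (φ : ℝ → ℂ) (n : ℤ) : ℂ :=
  (1 / (2 * Real.pi)) * ∫ θ in (0:ℝ)..(2 * Real.pi),
    φ θ * Complex.exp (-(n : ℂ) * (θ : ℂ) * Complex.I)

/-- The action of a distribution on a test function: `μ(φ) = ∑ₙ μ̂(n) φ̂(-n)`. -/
def distAct (μ : CircleDistribution) (φ : ℝ → ℂ) : ℂ := ∑' n : ℤ, μ.coeff n * testCoeff φ (-n)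

/-- The support of a distribution on the circle: the points of the circle having no open
neighbourhood `U` such that `μ` kills every test function supported in `U`. -/
def distSupport (μ : CircleDistribution) : Set ℂ :=
  {z ∈ Metric.sphere (0 : ℂ) 1 | ∀ U : Set ℂ, IsOpen U → z ∈ U →
    ∃ φ : ℝ → ℂ, PeriodicSmooth φ ∧
      (∀ θ : ℝ, Complex.exp ((θ : ℂ) * Complex.I) ∉ U → φ θ = 0) ∧ distAct μ φ ≠ 0}

/-- A set of multiplicity: a closed subset of the circle supporting a nonzero
pseudofunction (distribution whose Fourier coefficients tend to `0` as `|n| → ∞`). -/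
def IsMSet (E : Set ℂ) : Prop :=
  IsClosed E ∧ E ⊆ Metric.sphere (0 : ℂ) 1 ∧
  ∃ μ : CircleDistribution, μ.coeff ≠ 0 ∧ distSupport μ ⊆ E ∧
    Filter.Tendsto μ.coeff Filter.cofinite (nhds 0)

/-- A Dirichlet set: `sup_{z ∈ E} |z^{n_k} - 1| → 0` for some sequence `n_k → ∞`. -/
def IsDirichletSet (E : Set ℂ) : Prop :=
  ∃ n : ℕ → ℕ, Filter.Tendsto n Filter.atTop Filter.atTop ∧
    ∀ ε > 0, ∀ᶠ k in Filter.atTop, ∀ z ∈ E, ‖z ^ (n k) - 1‖ < ε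

/-- The real Cantor set of ratio `ξ` whose image under `x ↦ exp (2πix)` is `Eset ξ`. -/
def cantorReal (ξ : ℝ) : Set ℝ :=
  {x | ∃ ε : ℕ → ℕ, (∀ k, ε k ≤ 1) ∧ x = (1 - ξ) * ∑' k : ℕ, (ε k : ℝ) * ξ ^ k}

theorem mem_Eset_iff {ξ : ℝ} {z : ℂ} :
    z ∈ Eset ξ ↔ ∃ x ∈ cantorReal ξ, z = exp (2 * Real.pi * I * (x : ℂ)) := by
  constructor
  · rintro ⟨ε, hε, rfl⟩
    exact ⟨_, ⟨ε, hε, rfl⟩, rfl⟩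
  · rintro ⟨x, ⟨ε, hε, rfl⟩, rfl⟩
    exact ⟨ε, hε, rfl⟩

theorem summable_digits {ξ : ℝ} (h0 : 0 ≤ ξ) (h1 : ξ < 1) {ε : ℕ → ℕ} (hε : ∀ k, ε k ≤ 1) :
    Summable fun k => (ε k : ℝ) * ξ ^ k := by
  refine Summable.of_nonneg_of_le (fun k => by positivity) (fun k => ?_)
    (summable_geometric_of_lt_one h0 h1)
  have : (ε k : ℝ) ≤ 1 := by exact_mod_cast hε k
  exact mul_le_of_le_one_left (by positivity) this

theorem cantorReal_subset_Icc {ξ : ℝ} (h0 : 0 ≤ ξ) (h1 : ξ < 1) :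
    cantorReal ξ ⊆ Set.Icc 0 1 := by
  rintro x ⟨ε, hε, rfl⟩
  have hs := summable_digits h0 h1 hε
  have h2 : ∑' k, (ε k : ℝ) * ξ ^ k ≤ (1 - ξ)⁻¹ := by
    rw [← tsum_geometric_of_lt_one h0 h1]
    refine hs.tsum_le_tsum (fun k => ?_) (summable_geometric_of_lt_one h0 h1)
    have : (ε k : ℝ) ≤ 1 := by exact_mod_cast hε k
    exact mul_le_of_le_one_left (by positivity) this
  have h3 : 0 < 1 - ξ := by linarith
  refine ⟨mul_nonneg h3.le (tsum_nonneg fun k => by positivity), ?_⟩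
  calc _ ≤ (1 - ξ) * (1 - ξ)⁻¹ := by gcongr
    _ = 1 := mul_inv_cancel₀ h3.ne'

theorem cantorReal_first_digit {p : ℕ} (hp : 2 ≤ p) {x : ℝ} (hx : x ∈ cantorReal (1 / p)) :
    ∃ d : ℕ, (d = 0 ∨ d = p - 1) ∧ ∃ y ∈ cantorReal (1 / p), x = (d + y) / p := by
  obtain ⟨ε, hε, rfl⟩ := hx
  have hp' : (2 : ℝ) ≤ p := by exact_mod_cast hp
  have h1 : (1 : ℝ) / p < 1 := by rw [div_lt_one (by linarith)]; linarith
  have hs := summable_digits (by positivity) h1 hε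
  refine ⟨ε 0 * (p - 1), ?_, _, ⟨fun k => ε (k + 1), fun k => hε _, rfl⟩, ?_⟩
  · rcases Nat.le_one_iff_eq_zero_or_eq_one.1 (hε 0) with h | h <;> simp [h]
  · rw [hs.tsum_eq_zero_add]
    have : ∀ k, (ε (k + 1) : ℝ) * (1 / p) ^ (k + 1) = (1 / p) * ((ε (k + 1) : ℝ) * (1 / p) ^ k) :=
      fun k => by ring
    simp_rw [this, tsum_mul_left]
    have h1p : 1 ≤ p := by omega
    push_cast [Nat.cast_sub h1p]
    have : (p : ℝ) ≠ 0 := by positivity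
    field_simp

/-- The numerators over `p ^ N` of the left endpoints of the `N`-th stage Cantor intervals. -/
def cantorNum (p : ℕ) : ℕ → Finset ℕ
  | 0 => {0}
  | N + 1 => (cantorNum p N).image (fun m => p * m) ∪
      (cantorNum p N).image (fun m => p * m + (p - 1))

theorem card_cantorNum_le (p N : ℕ) : (cantorNum p N).card ≤ 2 ^ N := by
  induction N with
  | zero => simp [cantorNum]
  | succ N ih =>
    rw [cantorNum]
    calc _ ≤ _ := Finset.card_union_le _ _
      _ ≤ (cantorNum p N).card + (cantorNum p N).card :=
        add_le_add Finset.card_image_le Finset.card_image_le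
      _ ≤ 2 ^ (N + 1) := by rw [pow_succ]; omega

theorem cantorReal_prefix {p : ℕ} (hp : 2 ≤ p) {x : ℝ} (hx : x ∈ cantorReal (1 / p)) (N : ℕ) :
    ∃ m ∈ cantorNum p N, ∃ y ∈ cantorReal (1 / p), x = (m + y) / (p : ℝ) ^ N := by
  have hp0 : (p : ℝ) ≠ 0 := by positivity
  induction N with
  | zero => exact ⟨0, by simp [cantorNum], x, hx, by simp⟩
  | succ N ih =>
    obtain ⟨m, hm, y, hy, rfl⟩ := ih
    obtain ⟨d, hd, y', hy', rfl⟩ := cantorReal_first_digit hp hy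
    refine ⟨p * m + d, ?_, y', hy', ?_⟩
    · rw [cantorNum, Finset.mem_union, Finset.mem_image, Finset.mem_image]
      rcases hd with rfl | rfl
      · exact Or.inl ⟨m, hm, rfl⟩
      · exact Or.inr ⟨m, hm, rfl⟩
    · push_cast
      field_simp
      ring

theorem cantorNum_ancestor {p : ℕ} (hp : 2 ≤ p) {n N : ℕ} (hn : n ≤ N) {m : ℕ}
    (hm : m ∈ cantorNum p N) :
    ∃ l ∈ cantorNum p n, (l : ℝ) / (p : ℝ) ^ n ≤ m / (p : ℝ) ^ N ∧
      m / (p : ℝ) ^ N + 1 / (p : ℝ) ^ N ≤ l / (p : ℝ) ^ n + 1 / (p : ℝ) ^ n := by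
  have hp0 : (0 : ℝ) < p := by positivity
  induction N, hn using Nat.le_induction generalizing m with
  | base => exact ⟨m, hm, le_rfl, le_rfl⟩
  | succ N hN ih =>
    rw [cantorNum, Finset.mem_union, Finset.mem_image, Finset.mem_image] at hm
    obtain ⟨m', d, hm', hd, rfl⟩ : ∃ m' d : ℕ, m' ∈ cantorNum p N ∧ d + 1 ≤ p ∧ m = p * m' + d := by
      rcases hm with ⟨m', h, rfl⟩ | ⟨m', h, rfl⟩
      · exact ⟨m', 0, h, by omega, rfl⟩
      · exact ⟨m', p - 1, h, by omega, rfl⟩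
    obtain ⟨l, hl, h1, h2⟩ := ih hm'
    have hd' : (d : ℝ) + 1 ≤ p := by exact_mod_cast hd
    refine ⟨l, hl, h1.trans ?_, le_trans ?_ h2⟩
    · rw [div_le_div_iff₀ (by positivity) (by positivity), pow_succ]
      push_cast
      nlinarith [pow_pos hp0 N, mul_nonneg (pow_pos hp0 N).le (Nat.cast_nonneg (α := ℝ) d)]
    · rw [← add_div, ← add_div, div_le_div_iff₀ (by positivity) (by positivity), pow_succ]
      push_cast
      nlinarith [pow_pos hp0 N]

theorem norm_exp_two_pi_sub_le (x y : ℝ) :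
    ‖exp (2 * Real.pi * I * (x : ℂ)) - exp (2 * Real.pi * I * (y : ℂ))‖ ≤
      2 * Real.pi * |x - y| := by
  have h : exp (2 * Real.pi * I * (x : ℂ)) - exp (2 * Real.pi * I * (y : ℂ)) =
      exp (((2 * Real.pi * y : ℝ) : ℂ) * I) *
        (exp (I * ((2 * Real.pi * (x - y) : ℝ) : ℂ)) - 1) := by
    rw [mul_sub, ← Complex.exp_add, mul_one]
    congr 2 <;> · push_cast; ring
  rw [h, norm_mul, Complex.norm_exp_ofReal_mul_I, one_mul]
  refine (Real.norm_exp_I_mul_ofReal_sub_one_le).trans ?_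
  rw [Real.norm_eq_abs, abs_mul, abs_of_pos Real.two_pi_pos]

theorem norm_of_mem_Eset {ξ : ℝ} {z : ℂ} (hz : z ∈ Eset ξ) : ‖z‖ = 1 := by
  obtain ⟨x, -, rfl⟩ := mem_Eset_iff.1 hz
  rw [show 2 * Real.pi * I * (x : ℂ) = ((2 * Real.pi * x : ℝ) : ℂ) * I by push_cast; ring]
  exact Complex.norm_exp_ofReal_mul_I _

theorem pow_mem_Eset {p : ℕ} (hp : 2 ≤ p) {z : ℂ} (hz : z ∈ Eset (1 / p)) (n : ℕ) :
    z ^ p ^ n ∈ Eset (1 / p) := by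
  obtain ⟨x, hx, rfl⟩ := mem_Eset_iff.1 hz
  obtain ⟨m, -, y, hy, rfl⟩ := cantorReal_prefix hp hx n
  refine mem_Eset_iff.2 ⟨y, hy, ?_⟩
  have hp0 : (p : ℂ) ≠ 0 := by
    have : p ≠ 0 := by omega
    exact_mod_cast this
  rw [← Complex.exp_nat_mul]
  have : ((p ^ n : ℕ) : ℂ) * (2 * Real.pi * I * (((m + y) / (p : ℝ) ^ n : ℝ) : ℂ)) =
      2 * Real.pi * I * (y : ℂ) + m * (2 * Real.pi * I) := by
    push_cast
    field_simp
    ring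
  rw [this, Complex.exp_add, Complex.exp_nat_mul_two_pi_mul_I, mul_one]

theorem near_int_of_mem_Eset {p : ℕ} (hp : 3 ≤ p) {y : ℝ}
    (hy : exp (2 * Real.pi * I * (y : ℂ)) ∈ Eset (1 / p)) : ∃ k : ℤ, |y - k| ≤ 1 / 3 := by
  obtain ⟨x, hx, hxy⟩ := mem_Eset_iff.1 hy
  obtain ⟨n, hn⟩ := Complex.exp_eq_exp_iff_exists_int.1 hxy
  have hn' : y = x + n := by
    have h2 : (2 * Real.pi * I : ℂ) ≠ 0 := Complex.two_pi_I_ne_zero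
    have : (y : ℂ) = x + n := mul_left_cancel₀ h2 (by rw [hn]; ring)
    exact_mod_cast this
  have hp' : (3 : ℝ) ≤ p := by exact_mod_cast hp
  have h1 : (1 : ℝ) / p < 1 := by rw [div_lt_one (by linarith)]; linarith
  obtain ⟨d, hd, t, ht, rfl⟩ := cantorReal_first_digit (by omega) hx
  obtain ⟨ht0, ht1⟩ := cantorReal_subset_Icc (by positivity) h1 ht
  have hp0 : (0 : ℝ) < p := by linarith
  rcases hd with rfl | rfl
  · refine ⟨n, ?_⟩
    have : y - n = t / p := by rw [hn']; push_cast; ring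
    rw [this, abs_of_nonneg (by positivity), div_le_div_iff₀ hp0 (by norm_num)]
    linarith
  · refine ⟨n + 1, ?_⟩
    have h1p : 1 ≤ p := by omega
    have : y - ((n + 1 : ℤ) : ℝ) = -((1 - t) / p) := by
      rw [hn']; push_cast [Nat.cast_sub h1p]; field_simp; ring
    rw [this, abs_neg, abs_of_nonneg (div_nonneg (by linarith) hp0.le),
      div_le_div_iff₀ hp0 (by norm_num)]
    linarith

theorem ringInverse_eq_of_mul_eq_one {A : Type*} [Ring A] {a b : A} (h1 : a * b = 1)
    (h2 : b * a = 1) :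
    Ring.inverse a = b := Ring.inverse_unit ⟨a, b, h1, h2⟩

section BanachAlgebra

variable {A : Type*} [NormedRing A] [CompleteSpace A]

theorem ringInverse_one_sub_of_summable {v : A} (h : Summable fun k => ‖v ^ k‖) :
    IsUnit (1 - v) ∧ Ring.inverse (1 - v) = ∑' k, v ^ k := by
  have hs : Summable fun k => v ^ k := h.of_norm
  have h1 := hs.one_sub_mul_tsum_pow
  have h2 := hs.tsum_pow_mul_one_sub
  exact ⟨⟨⟨_, _, h1, h2⟩, rfl⟩, ringInverse_eq_of_mul_eq_one h1 h2⟩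

theorem norm_ringInverse_one_sub_mul_le {v : A} {x : A} {b : ℕ → ℝ}
    (h : Summable fun k => ‖v ^ k‖) (hb : Summable b) (hx : ∀ k, ‖v ^ k * x‖ ≤ b k) :
    ‖Ring.inverse (1 - v) * x‖ ≤ ∑' k, b k := by
  rw [(ringInverse_one_sub_of_summable h).2, ← (h.of_norm).tsum_mul_right]
  exact tsum_of_norm_bounded hb.hasSum hx

variable [NormedAlgebra ℂ A]

/-- Resolvent bound for a power-bounded element. -/
theorem norm_ringInverse_smul_sub_le_of_pow_bounded {u : A} {L : ℝ} {x : A} {a b : ℂ}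
    (h : ∀ k, ‖u ^ k‖ ≤ L) (hx : ∀ k, ‖u ^ k * x‖ ≤ L) (hab : ‖b‖ < ‖a‖) :
    ‖Ring.inverse (a • 1 - b • u) * x‖ ≤ L / (‖a‖ - ‖b‖) := by
  have ha : a ≠ 0 := by
    rintro rfl
    simp at hab
    exact absurd hab (not_lt.2 (norm_nonneg _))
  have ha' : 0 < ‖a‖ := norm_pos_iff.2 ha
  have hr1 : ‖b / a‖ < 1 := by rw [norm_div, div_lt_one ha']; exact hab
  have hgs := (summable_geometric_of_lt_one (norm_nonneg (b / a)) hr1).mul_left L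
  have hv : ∀ y : A, (∀ k, ‖u ^ k * y‖ ≤ L) → ∀ k, ‖((b / a) • u) ^ k * y‖ ≤ L * ‖b / a‖ ^ k := by
    intro y hy k
    rw [smul_pow, smul_mul_assoc, norm_smul, norm_pow, mul_comm]
    exact mul_le_mul_of_nonneg_right (hy k) (by positivity)
  have hsum : Summable fun k => ‖((b / a) • u) ^ k‖ :=
    Summable.of_nonneg_of_le (fun _ => norm_nonneg _)
      (fun k => by simpa using hv 1 (by simpa using h) k) hgs
  have h1 := norm_ringInverse_one_sub_mul_le (x := x) hsum hgs (hv x hx)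
  obtain ⟨w, hw⟩ := (ringInverse_one_sub_of_summable hsum).1
  have e : a • 1 - b • u = a • (1 - (b / a) • u) := by
    rw [smul_sub, smul_smul, mul_div_cancel₀ _ ha]
  have h2 : Ring.inverse (a • 1 - b • u) = a⁻¹ • Ring.inverse (1 - (b / a) • u) := by
    rw [e, ← hw, Ring.inverse_unit]
    refine ringInverse_eq_of_mul_eq_one ?_ ?_
    · rw [smul_mul_smul_comm, Units.mul_inv, mul_inv_cancel₀ ha, one_smul]
    · rw [smul_mul_smul_comm, Units.inv_mul, inv_mul_cancel₀ ha, one_smul]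
  rw [h2, smul_mul_assoc, norm_smul, norm_inv]
  rw [tsum_mul_left, tsum_geometric_of_lt_one (norm_nonneg _) hr1, norm_div] at h1
  calc _ ≤ ‖a‖⁻¹ * (L * (1 - ‖b‖ / ‖a‖)⁻¹) := by gcongr
    _ = _ := by
      have : 0 < ‖a‖ - ‖b‖ := by linarith
      have h3 : 1 - ‖b‖ / ‖a‖ = (‖a‖ - ‖b‖) / ‖a‖ := by field_simp
      rw [h3]; field_simp

theorem hasDerivAt_ringInverse_one_sub_smul (a : A) {z : ℂ} (hz : IsUnit (1 - z • a)) :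
    DifferentiableAt ℂ (fun w : ℂ => Ring.inverse (1 - w • a)) z := by
  obtain ⟨w, hw⟩ := hz
  have h := (hasFDerivAt_ringInverse (𝕜 := ℂ) w).differentiableAt
  rw [hw] at h
  exact DifferentiableAt.comp z (f := fun w : ℂ => 1 - w • a) h (by fun_prop)

theorem deriv_ringInverse_one_sub_smul_zero (a : A) :
    deriv (fun w : ℂ => Ring.inverse (1 - w • a)) 0 = a := by
  have h := hasFDerivAt_ringInverse (𝕜 := ℂ) (1 : Aˣ)
  have h2 : HasDerivAt (fun w : ℂ => 1 - w • a) (-a) 0 := by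
    simpa using ((hasDerivAt_id (0 : ℂ)).smul_const a).const_sub 1
  rw [show ((1 : Aˣ) : A) = 1 - (0 : ℂ) • a by simp] at h
  have h4 := h.comp_hasDerivAt (0 : ℂ) h2
  rw [show (fun w : ℂ => Ring.inverse (1 - w • a)) =
    Ring.inverse ∘ (fun w : ℂ => 1 - w • a) from rfl,
    h4.deriv]
  simp

theorem isUnit_one_sub_smul_of_spectrum {A : Type*} [Ring A] [Algebra ℂ A] {u : A} {r : ℝ}
    (hr : 0 < r) (hσ : ∀ z ∈ spectrum ℂ u, ‖z - 1‖ < 1 / r) {z : ℂ} (hz : ‖z‖ ≤ r) :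
    IsUnit (1 - z • (u - 1)) := by
  by_cases h0 : z = 0
  · simp [h0]
  have hn : (1 + z⁻¹) ∉ spectrum ℂ u := fun h => by
    have := hσ _ h
    rw [add_sub_cancel_left, norm_inv, ← one_div] at this
    have h1 : 0 < ‖z‖ := norm_pos_iff.2 h0
    rw [div_lt_div_iff₀ h1 hr] at this
    linarith
  rw [spectrum.notMem_iff] at hn
  have e : 1 - z • (u - 1) = (Units.mk0 z h0) • (algebraMap ℂ A (1 + z⁻¹) - u) := by
    rw [Algebra.algebraMap_eq_smul_one, Units.smul_def, Units.val_mk0, add_smul, smul_sub, smul_sub,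
      smul_add, smul_smul, smul_smul, mul_inv_cancel₀ h0]
    simp only [one_smul, mul_one]
    abel
  rw [e]
  exact hn.smul _

theorem norm_ringInverse_one_sub_smul_le (u : Aˣ) {L : ℝ} (h : ∀ k, ‖(u : A) ^ k‖ ≤ L)
    (h' : ∀ k, ‖((u⁻¹ : Aˣ) : A) ^ k‖ ≤ L) {z : ℂ} (hz : ‖1 + z‖ ≠ ‖z‖) :
    ‖Ring.inverse (1 - z • ((u : A) - 1))‖ ≤ L / |‖1 + z‖ - ‖z‖| := by
  rcases lt_or_gt_of_ne hz with hlt | hlt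
  · have hx : ∀ k, ‖((u⁻¹ : Aˣ) : A) ^ k * ((u⁻¹ : Aˣ) : A)‖ ≤ L := fun k => by
      rw [← pow_succ]; exact h' _
    have := norm_ringInverse_smul_sub_le_of_pow_bounded h' hx hlt
    rw [abs_of_neg (by linarith), neg_sub]
    refine le_trans (le_of_eq ?_) this
    have e : (1 - z • ((u : A) - 1)) = (-u : Aˣ) * (z • 1 - (1 + z) • ((u⁻¹ : Aˣ) : A)) := by
      rw [Units.val_neg, neg_mul, mul_sub, mul_smul_comm, mul_smul_comm, Units.mul_inv, mul_one,
        smul_sub, add_smul, one_smul]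
      abel
    rw [e, Ring.mul_inverse_rev' (by
      refine Commute.sub_right ?_ ?_
      · exact (Commute.one_right _).smul_right _
      · refine Commute.smul_right ?_ _
        simp [Commute, SemiconjBy])]
    rw [Ring.inverse_unit]
    simp
  · have := norm_ringInverse_smul_sub_le_of_pow_bounded (x := 1) h (by simpa using h) hlt
    rw [abs_of_pos (by linarith)]
    have e : (1 - z • ((u : A) - 1)) = (1 + z) • 1 - z • (u : A) := by
      rw [smul_sub, add_smul, one_smul]; abel
    rw [e]
    simpa using this

/-- A doubly power-bounded unit with spectrum near `1` is near `1`. -/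
theorem norm_unit_sub_one_le (u : Aˣ) {L s : ℝ} (hs : 1 < s) (h : ∀ k, ‖(u : A) ^ k‖ ≤ L)
    (h' : ∀ k, ‖((u⁻¹ : Aˣ) : A) ^ k‖ ≤ L)
    (hσ : ∀ z ∈ spectrum ℂ (u : A), ‖z - 1‖ < 1 / (s + 1 / 2)) :
    ‖(u : A) - 1‖ ≤ 8 * L / (s - 1) := by
  have hs0 : 0 < s := by linarith
  have hL : 0 ≤ L := (norm_nonneg _).trans (h 0)
  set W : ℂ → A := fun z => Ring.inverse (1 - z • ((u : A) - 1)) with hW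
  have hdW : ∀ z : ℂ, ‖z‖ ≤ s + 1 / 2 → DifferentiableAt ℂ W z := fun z hz =>
    hasDerivAt_ringInverse_one_sub_smul _ (isUnit_one_sub_smul_of_spectrum (by linarith) hσ hz)
  have hshift : ∀ η : ℂ, ‖η‖ ≤ s → ‖η - 1 / 2‖ ≤ s + 1 / 2 := fun η hη =>
    (norm_sub_le _ _).trans (by norm_num; linarith)
  set V : ℂ → A := fun η => ((η ^ 2 + (s : ℂ) ^ 2) / (s : ℂ) ^ 2) • W (η - 1 / 2) with hV
  have hdV : ∀ η : ℂ, ‖η‖ ≤ s → DifferentiableAt ℂ V η := fun η hη => by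
    have : DifferentiableAt ℂ (fun η : ℂ => W (η - 1 / 2)) η :=
      DifferentiableAt.comp η (f := fun η : ℂ => η - 1 / 2) (hdW _ (hshift η hη)) (by fun_prop)
    have h0 : DifferentiableAt ℂ (fun η : ℂ => (η ^ 2 + (s : ℂ) ^ 2) / (s : ℂ) ^ 2) η := by fun_prop
    exact h0.smul this
  have hVb : ∀ η ∈ sphere (0 : ℂ) s, ‖V η‖ ≤ 3 * L := by
    intro η hη
    have hη' : ‖η‖ = s := by simpa using hη
    have e1 : η ^ 2 + (s : ℂ) ^ 2 = η * ((2 * η.re : ℝ) : ℂ) := by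
      have : (s : ℂ) ^ 2 = η * (starRingEnd ℂ) η := by rw [Complex.mul_conj']; rw [hη']
      rw [this, ← Complex.add_conj]; ring
    have e2 : ‖(η ^ 2 + (s : ℂ) ^ 2) / (s : ℂ) ^ 2‖ = 2 * |η.re| / s := by
      rw [e1, norm_div, norm_mul, hη', Complex.norm_real, norm_pow, Complex.norm_real]
      simp only [Real.norm_eq_abs, abs_mul, abs_of_pos hs0, abs_two]
      field_simp
    rw [hV, norm_smul, e2]
    by_cases hre : η.re = 0
    · simp [hre, hL]
    have hn1 : ‖1 + (η - 1 / 2)‖ ^ 2 - ‖η - 1 / 2‖ ^ 2 = 2 * η.re := by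
      rw [← Complex.normSq_eq_norm_sq, ← Complex.normSq_eq_norm_sq]
      simp [Complex.normSq_apply]
      ring
    have hb1 : ‖1 + (η - 1 / 2)‖ ≤ s + 1 / 2 := by
      rw [show 1 + (η - 1 / 2) = η + 1 / 2 by ring, ← hη']
      exact (norm_add_le _ _).trans (by norm_num)
    have hb2 := hshift η hη'.le
    have hne : ‖1 + (η - 1 / 2)‖ ≠ ‖η - 1 / 2‖ := fun h => by
      rw [h] at hn1; apply hre; linarith
    have hWb := norm_ringInverse_one_sub_smul_le u h h' hne
    have hprod : 2 * |η.re| =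
        |‖1 + (η - 1 / 2)‖ - ‖η - 1 / 2‖| * (‖1 + (η - 1 / 2)‖ + ‖η - 1 / 2‖) := by
      rw [← abs_two (α := ℝ), ← abs_mul, ← hn1, sq_sub_sq, abs_mul, mul_comm,
        abs_of_nonneg (a := _ + _) (by positivity)]
    have hd : 0 < |‖1 + (η - 1 / 2)‖ - ‖η - 1 / 2‖| := abs_pos.2 (sub_ne_zero.2 hne)
    calc 2 * |η.re| / s * ‖W (η - 1 / 2)‖
        ≤ 2 * |η.re| / s * (L / |‖1 + (η - 1 / 2)‖ - ‖η - 1 / 2‖|) := by gcongr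
      _ = (‖1 + (η - 1 / 2)‖ + ‖η - 1 / 2‖) / s * L := by
        rw [hprod]
        generalize |‖1 + (η - 1 / 2)‖ - ‖η - 1 / 2‖| = t at hd
        field_simp
      _ ≤ 3 * L := by
        gcongr
        rw [div_le_iff₀ hs0]; linarith
  have hVin : ∀ η : ℂ, ‖η‖ ≤ s → ‖V η‖ ≤ 3 * L := by
    intro η hη
    refine Complex.norm_le_of_forall_mem_frontier_norm_le (U := ball (0 : ℂ) s) isBounded_ball
      ?_ ?_ ?_
    · refine DifferentiableOn.diffContOnCl fun z hz => ?_
      rw [closure_ball _ hs0.ne', mem_closedBall_zero_iff] at hz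
      exact (hdV z hz).differentiableWithinAt
    · rw [frontier_ball _ hs0.ne']; exact hVb
    · rw [closure_ball _ hs0.ne']; simpa using hη
  have hWin : ∀ η : ℂ, ‖η‖ ≤ s / 2 → ‖W (η - 1 / 2)‖ ≤ 4 * L := by
    intro η hη
    have h1 := hVin η (by linarith)
    rw [hV, norm_smul] at h1
    have h2 : 3 / 4 ≤ ‖(η ^ 2 + (s : ℂ) ^ 2) / (s : ℂ) ^ 2‖ := by
      rw [norm_div, norm_pow, Complex.norm_real, Real.norm_eq_abs, abs_of_pos hs0,
        le_div_iff₀ (by positivity)]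
      have h3 : ‖η ^ 2 + (s : ℂ) ^ 2‖ ≥ ‖(s : ℂ) ^ 2‖ - ‖η ^ 2‖ := by
        have := norm_sub_norm_le ((s : ℂ) ^ 2) (-η ^ 2)
        rwa [norm_neg, sub_neg_eq_add, add_comm] at this
      rw [norm_pow, norm_pow, Complex.norm_real, Real.norm_eq_abs, abs_of_pos hs0] at h3
      nlinarith [norm_nonneg η]
    nlinarith [norm_nonneg (W (η - 1 / 2))]
  have hr : 0 < (s - 1) / 2 := by linarith
  have hc := Complex.norm_deriv_le_of_forall_mem_sphere_norm_le (c := 0) (f := W) (C := 4 * L) hr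
    (DifferentiableOn.diffContOnCl fun z hz => ?_) (fun z hz => ?_)
  · rw [hW, deriv_ringInverse_one_sub_smul_zero] at hc
    refine hc.trans (le_of_eq ?_)
    field_simp
    ring
  · rw [closure_ball _ hr.ne', mem_closedBall_zero_iff] at hz
    exact (hdW z (by linarith)).differentiableWithinAt
  · have hz' : ‖z‖ = (s - 1) / 2 := by simpa using hz
    have := hWin (z + 1 / 2) ((norm_add_le _ _).trans (by rw [hz']; norm_num; linarith))
    simpa using this

theorem mul_rpow_le_add {α B y t : ℝ} (hα0 : 0 < α) (hα1 : α < 1) (hB : 0 ≤ B) (hy : 0 < y)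
    (ht : 0 < t) :
    B * t ^ α ≤ y * t / 2 + B * (2 * B) ^ (α / (1 - α)) * y ^ (-(α / (1 - α))) := by
  have h1 : 0 < 1 - α := by linarith
  by_cases h : B * t ^ α ≤ y * t / 2
  · have : 0 ≤ B * (2 * B) ^ (α / (1 - α)) * y ^ (-(α / (1 - α))) := by positivity
    linarith
  · push Not at h
    have h2 : t ^ (1 - α) ≤ 2 * B / y := by
      rw [le_div_iff₀ hy, Real.rpow_sub ht, Real.rpow_one, div_mul_eq_mul_div,
        div_le_iff₀ (by positivity)]
      linarith
    have h3 : t ^ α ≤ (2 * B / y) ^ (α / (1 - α)) := by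
      calc t ^ α = (t ^ (1 - α)) ^ (α / (1 - α)) := by
            rw [← Real.rpow_mul ht.le]; congr 1; field_simp
        _ ≤ _ := by gcongr
    have h4 : B * t ^ α ≤ B * (2 * B) ^ (α / (1 - α)) * y ^ (-(α / (1 - α))) := by
      rw [Real.rpow_neg hy.le, mul_assoc, ← div_eq_mul_inv, ← Real.div_rpow (by positivity) hy.le]
      gcongr
    have : 0 ≤ y * t / 2 := by positivity
    linarith

theorem one_div_le_exp_rpow_neg {γ y : ℝ} (hγ : 0 < γ) (hy : 0 < y) :
    1 / y ≤ Real.exp (1 / γ * y ^ (-γ)) := by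
  rw [← Real.log_le_iff_le_exp (by positivity)]
  have := Real.log_le_rpow_div (x := 1 / y) (by positivity) hγ
  rw [one_div, Real.inv_rpow hy.le, ← Real.rpow_neg hy.le] at this
  rw [one_div]
  calc _ ≤ _ := this
    _ = _ := by ring

variable [NormOneClass A]

/-- Growth of the resolvent near the unit circle for a contraction whose inverse has
subexponential power growth. -/
theorem norm_resolvent_exp_le (u : Aˣ) (hu : ‖(u : A)‖ ≤ 1) {α B : ℝ} (hα0 : 0 < α) (hα1 : α < 1)
    (hB : ∀ k : ℕ, 1 ≤ k → ‖((u⁻¹ : Aˣ) : A) ^ k‖ ≤ Real.exp (B * (k : ℝ) ^ α)) :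
    ∃ K : ℝ, 0 ≤ K ∧ ∀ w : ℂ, w.re ≠ 0 → |w.re| ≤ 1 →
      ‖resolvent (u : A) (exp w)‖ ≤ Real.exp (K * |w.re| ^ (-(α / (1 - α)))) := by
  have h1 : 0 < 1 - α := by linarith
  set γ := α / (1 - α) with hγ
  have hγ0 : 0 < γ := div_pos hα0 h1
  set D := |B| * (2 * |B|) ^ γ with hD
  have hD0 : 0 ≤ D := by positivity
  refine ⟨D + (2 + 1 / γ), by positivity, fun w hw0 hw1 => ?_⟩
  have habs : 0 < |w.re| := abs_pos.2 hw0
  have hone : 1 ≤ |w.re| ^ (-γ) :=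
    Real.one_le_rpow_of_pos_of_le_one_of_nonpos habs hw1 (by linarith)
  have hz : ‖exp w‖ = Real.exp w.re := Complex.norm_exp w
  rcases lt_or_gt_of_ne hw0 with hneg | hpos
  · set y := |w.re| with hy
    have hre : w.re = -y := by rw [hy, abs_of_neg hneg]; ring
    set v : A := exp w • ((u⁻¹ : Aˣ) : A) with hv
    have hpow : ∀ k : ℕ, ‖((u⁻¹ : Aˣ) : A) ^ (k + 1)‖ ≤
        Real.exp (y / 2 + y / 2 * k + D * y ^ (-γ)) := fun k => by
      refine (hB (k + 1) (by omega)).trans (Real.exp_le_exp.2 ?_)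
      have := mul_rpow_le_add hα0 hα1 (abs_nonneg B) habs
        (show (0 : ℝ) < ((k + 1 : ℕ) : ℝ) by positivity)
      calc _ ≤ |B| * ((k + 1 : ℕ) : ℝ) ^ α := by gcongr; exact le_abs_self B
        _ ≤ _ := this
        _ = _ := by push_cast; ring
    have hb : ∀ k : ℕ, Real.exp (-y) ^ k * Real.exp (y / 2 + y / 2 * k + D * y ^ (-γ)) =
        Real.exp (y / 2 + D * y ^ (-γ)) * Real.exp (-(y / 2)) ^ k := fun k => by
      rw [← Real.exp_nat_mul, ← Real.exp_nat_mul, ← Real.exp_add, ← Real.exp_add]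
      congr 1; ring
    have hgs := summable_geometric_of_lt_one (Real.exp_pos (-(y / 2))).le
      (Real.exp_lt_one_iff.2 (by linarith))
    have hx : ∀ k, ‖v ^ k * ((u⁻¹ : Aˣ) : A)‖ ≤
        Real.exp (y / 2 + D * y ^ (-γ)) * Real.exp (-(y / 2)) ^ k := fun k => by
      rw [hv, smul_pow, smul_mul_assoc, norm_smul, norm_pow, hz, hre, ← pow_succ, ← hb]
      gcongr
      exact hpow k
    have hsum : Summable fun k => ‖v ^ k‖ := by
      refine (summable_nat_add_iff 1).1 ?_
      refine Summable.of_nonneg_of_le (fun _ => norm_nonneg _) (fun k => ?_)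
        (hgs.mul_left (Real.exp (y / 2 + D * y ^ (-γ))))
      refine le_trans ?_ (hx k)
      rw [pow_succ, hv, mul_smul_comm, norm_smul, hz]
      exact mul_le_of_le_one_left (norm_nonneg _) (Real.exp_le_one_iff.2 hneg.le)
    have hR : resolvent (u : A) (exp w) = -(Ring.inverse (1 - v) * ((u⁻¹ : Aˣ) : A)) := by
      obtain ⟨t, ht⟩ := (ringInverse_one_sub_of_summable hsum).1
      have e : algebraMap ℂ A (exp w) - u = ((-u * t : Aˣ) : A) := by
        rw [Units.val_mul, ht, Units.val_neg, hv, neg_mul, mul_sub, mul_smul_comm, Units.mul_inv,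
          Algebra.algebraMap_eq_smul_one, mul_one]
        abel
      rw [resolvent, e, Ring.inverse_unit, ← ht, Ring.inverse_unit, mul_inv_rev, Units.val_mul]
      simp
    rw [hR, norm_neg]
    refine (norm_ringInverse_one_sub_mul_le hsum (hgs.mul_left _) hx).trans ?_
    rw [tsum_mul_left, tsum_geometric_of_lt_one (Real.exp_pos _).le
      (Real.exp_lt_one_iff.2 (by linarith))]
    have h5 : (1 - Real.exp (-(y / 2)))⁻¹ ≤ Real.exp (3 / 2 + 1 / γ * y ^ (-γ)) := by
      have e1 : Real.exp (-(y / 2)) * (1 + y / 2) ≤ 1 := by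
        rw [Real.exp_neg]
        have := Real.add_one_le_exp (y / 2)
        rw [inv_mul_le_iff₀ (Real.exp_pos _)]; linarith
      have e2 : 0 < Real.exp (-(y / 2)) := Real.exp_pos _
      have e3 : Real.exp (-(1 / 2)) * y ≤ 2 * (1 - Real.exp (-(y / 2))) := by
        have : Real.exp (-(1 / 2)) ≤ Real.exp (-(y / 2)) := Real.exp_le_exp.2 (by linarith)
        nlinarith
      rw [show (3 / 2 + 1 / γ * y ^ (-γ) : ℝ) = 1 + 1 / 2 + 1 / γ * y ^ (-γ) by ring, Real.exp_add,
        Real.exp_add]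
      have e4 := one_div_le_exp_rpow_neg hγ0 habs
      have e5 : 2 ≤ Real.exp 1 := by linarith [Real.add_one_le_exp 1]
      calc (1 - Real.exp (-(y / 2)))⁻¹ ≤ (Real.exp (-(1 / 2)) * y / 2)⁻¹ := by
            gcongr
            linarith
        _ = 2 * Real.exp (1 / 2) * (1 / y) := by rw [Real.exp_neg]; field_simp
        _ ≤ _ := by gcongr
    calc _ ≤ Real.exp (y / 2 + D * y ^ (-γ)) * Real.exp (3 / 2 + 1 / γ * y ^ (-γ)) := by gcongr
      _ = Real.exp (y / 2 + D * y ^ (-γ) + (3 / 2 + 1 / γ * y ^ (-γ))) := (Real.exp_add _ _).symm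
      _ ≤ _ := by
        apply Real.exp_le_exp.2
        nlinarith
  · have hpw : ∀ k, ‖(u : A) ^ k‖ ≤ 1 := fun k =>
      (norm_pow_le _ _).trans (pow_le_one₀ (norm_nonneg _) hu)
    have hlt : ‖(1 : ℂ)‖ < ‖exp w‖ := by
      rw [hz, norm_one]; exact Real.one_lt_exp_iff.2 hpos
    have := norm_ringInverse_smul_sub_le_of_pow_bounded (x := 1) hpw (by simpa using hpw) hlt
    rw [mul_one, one_smul, ← Algebra.algebraMap_eq_smul_one, hz, norm_one] at this
    rw [abs_of_pos hpos] at hone ⊢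
    calc _ ≤ _ := this
      _ ≤ 1 / w.re := by
        gcongr
        linarith [Real.add_one_le_exp w.re]
      _ ≤ Real.exp (1 / γ * w.re ^ (-γ)) := one_div_le_exp_rpow_neg hγ0 hpos
      _ ≤ _ := by
        gcongr
        linarith

end BanachAlgebra

theorem cos_mul_rpow_le_re_cpow {γ : ℝ} (h0 : 0 < γ) (h1 : γ < 1) {z : ℂ} (hz : 0 < z.re) :
    Real.cos (γ * (Real.pi / 2)) * ‖z‖ ^ (-γ) ≤ (z ^ (-γ : ℂ)).re := by
  have hz0 : z ≠ 0 := fun h => by simp [h] at hz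
  have hn : 0 < ‖z‖ := norm_pos_iff.2 hz0
  have harg : |z.arg| ≤ Real.pi / 2 := Complex.abs_arg_le_pi_div_two_iff.2 hz.le
  have e : (z ^ (-γ : ℂ)).re = ‖z‖ ^ (-γ) * Real.cos (γ * |z.arg|) := by
    rw [Complex.cpow_def_of_ne_zero hz0, Complex.exp_re]
    have h2 : (log z * (-γ : ℂ)).re = Real.log ‖z‖ * (-γ) := by
      rw [← Complex.ofReal_neg, Complex.re_mul_ofReal, Complex.log_re]
    have h3 : (log z * (-γ : ℂ)).im = z.arg * (-γ) := by
      rw [← Complex.ofReal_neg, Complex.im_mul_ofReal, Complex.log_im]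
    rw [h2, h3, ← Real.rpow_def_of_pos hn, mul_neg, Real.cos_neg, ← Real.cos_abs (z.arg * γ),
      abs_mul, abs_of_pos h0, mul_comm |z.arg|]
  rw [e, mul_comm]
  gcongr
  have := Real.pi_pos
  apply Real.cos_le_cos_of_nonneg_of_le_pi (by positivity) (by nlinarith)
  gcongr

/-- A function of exponential growth of order less than one near the imaginary axis is bounded
across it. -/
theorem norm_le_exp_of_growth {F : Type*} [NormedAddCommGroup F] [NormedSpace ℂ F]
    {γ : ℝ} (h0 : 0 < γ) (h1 : γ < 1) {K : ℝ} (hK : 0 < K) {f : ℂ → F}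
    (hd : ∀ w : ℂ, |w.re| ≤ 1 → |w.im| ≤ 1 → DifferentiableAt ℂ f w)
    (hb : ∀ w : ℂ, w.re ≠ 0 → |w.re| ≤ 1 → |w.im| ≤ 1 → ‖f w‖ ≤ Real.exp (K * |w.re| ^ (-γ)))
    {x : ℝ} (hx : |x| ≤ 1) :
    ‖f x‖ ≤ Real.exp ((1 + 2 * (2 ^ γ / Real.cos (γ * (Real.pi / 2)))) * K) := by
  have hpi := Real.pi_pos
  have hc : 0 < Real.cos (γ * (Real.pi / 2)) :=
    Real.cos_pos_of_mem_Ioo ⟨by nlinarith, by nlinarith⟩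
  set c := Real.cos (γ * (Real.pi / 2)) with hcdef
  set K' := 2 ^ γ / c * K with hK'
  have hK'0 : 0 < K' := by positivity
  set S : Set ℂ := Set.Ioo (-1 : ℝ) 1 ×ℂ Set.Ioo (-1 : ℝ) 1 with hS
  have hcl : closure S = Set.Icc (-1 : ℝ) 1 ×ℂ Set.Icc (-1 : ℝ) 1 := by
    rw [hS, Complex.closure_reProdIm, closure_Ioo (by norm_num)]
  have hcl' : ∀ w ∈ closure S, |w.re| ≤ 1 ∧ |w.im| ≤ 1 := fun w hw => by
    rw [hcl, Complex.mem_reProdIm] at hw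
    exact ⟨abs_le.2 hw.1, abs_le.2 hw.2⟩
  have hbdd : Bornology.IsBounded S :=
    Bornology.IsBounded.reProdIm (Metric.isBounded_Ioo _ _) (Metric.isBounded_Ioo _ _)
  obtain ⟨M, hM⟩ : ∃ M : ℝ, ∀ w ∈ closure S, ‖f w‖ ≤ M :=
    (hbdd.isCompact_closure).exists_bound_of_continuousOn fun w hw =>
      (hd w (hcl' w hw).1 (hcl' w hw).2).continuousAt.continuousWithinAt
  set Q := |M| / (K' * c) + 1 with hQ
  have hQ0 : 0 < Q := by positivity
  set η := Q ^ (-(1 / γ)) / 2 with hη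
  have hη0 : 0 < η := by positivity
  have hηQ : (2 * η) ^ (-γ) = Q := by
    rw [hη, mul_div_cancel₀ _ two_ne_zero, ← Real.rpow_mul hQ0.le]
    rw [show -(1 / γ) * -γ = 1 by field_simp, Real.rpow_one]
  set g : ℂ → ℂ := fun w =>
    exp (-(K' : ℂ) * ((1 + η + I * w) ^ (-γ : ℂ) + (1 + η - I * w) ^ (-γ : ℂ))) with hg
  have hre1 : ∀ w : ℂ, (1 + (η : ℂ) + I * w).re = 1 + η - w.im := fun w => by simp; ring
  have hre2 : ∀ w : ℂ, (1 + (η : ℂ) - I * w).re = 1 + η + w.im := fun w => by simp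
  have him1 : ∀ w : ℂ, (1 + (η : ℂ) + I * w).im = w.re := fun w => by simp
  have him2 : ∀ w : ℂ, (1 + (η : ℂ) - I * w).im = -w.re := fun w => by simp
  have hgn : ∀ w, ‖g w‖ = Real.exp (-K' * (((1 + η + I * w) ^ (-γ : ℂ)).re +
      ((1 + η - I * w) ^ (-γ : ℂ)).re)) := fun w => by
    rw [hg, Complex.norm_exp, ← Complex.ofReal_neg, Complex.re_ofReal_mul, Complex.add_re]
  have hgd : ∀ w : ℂ, |w.im| ≤ 1 → DifferentiableAt ℂ g w := fun w hw => by
    have := abs_le.1 hw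
    have s1 : (1 + (η : ℂ) + I * w) ∈ slitPlane := Or.inl (by rw [hre1]; linarith)
    have s2 : (1 + (η : ℂ) - I * w) ∈ slitPlane := Or.inl (by rw [hre2]; linarith)
    have d1 : DifferentiableAt ℂ (fun w : ℂ => (1 + (η : ℂ) + I * w) ^ (-γ : ℂ)) w :=
      DifferentiableAt.cpow_const (by fun_prop) s1
    have d2 : DifferentiableAt ℂ (fun w : ℂ => (1 + (η : ℂ) - I * w) ^ (-γ : ℂ)) w :=
      DifferentiableAt.cpow_const (by fun_prop) s2
    exact ((d1.add d2).const_mul _).cexp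
  have hfr : ∀ w ∈ frontier S, ‖g w • f w‖ ≤ Real.exp K := by
    intro w hw
    have hwcl := frontier_subset_closure hw
    obtain ⟨hx1, hy1⟩ := hcl' w hwcl
    have hyy := abs_le.1 hy1
    have p1 := cos_mul_rpow_le_re_cpow h0 h1 (z := 1 + (η : ℂ) + I * w) (by rw [hre1]; linarith)
    have p2 := cos_mul_rpow_le_re_cpow h0 h1 (z := 1 + (η : ℂ) - I * w) (by rw [hre2]; linarith)
    rw [← hcdef] at p1 p2
    have q1 : 0 ≤ c * ‖1 + (η : ℂ) + I * w‖ ^ (-γ) := by positivity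
    have q2 : 0 ≤ c * ‖1 + (η : ℂ) - I * w‖ ^ (-γ) := by positivity
    rw [norm_smul]
    rw [hS, Complex.frontier_reProdIm, closure_Ioo (by norm_num), frontier_Ioo (by norm_num)] at hw
    rcases hw with hw | hw
    · obtain ⟨-, hwim⟩ := hw
      have key : ∃ z : ℂ, ‖z‖ ≤ η + |w.re| ∧ 0 < ‖z‖ ∧
        ‖g w‖ ≤ Real.exp (-K' * (c * ‖z‖ ^ (-γ))) := by
        rcases hwim with hi | hi
        · refine ⟨1 + (η : ℂ) - I * w, ?_, norm_pos_iff.2 fun h => ?_, ?_⟩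
          · refine (Complex.norm_le_abs_re_add_abs_im _).trans ?_
            rw [hre2, him2, hi, abs_neg]
            simp [abs_of_pos hη0]
          · have := hre2 w
            rw [h, hi] at this; simp at this; linarith
          · rw [hgn]; apply Real.exp_le_exp.2; nlinarith
        · rw [Set.mem_singleton_iff] at hi
          refine ⟨1 + (η : ℂ) + I * w, ?_, norm_pos_iff.2 fun h => ?_, ?_⟩
          · refine (Complex.norm_le_abs_re_add_abs_im _).trans ?_
            rw [hre1, him1, hi]
            simp [abs_of_pos hη0]
          · have := hre1 w
            rw [h, hi] at this; simp at this; linarith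
          · rw [hgn]; apply Real.exp_le_exp.2; nlinarith
      obtain ⟨z, hz1, hz0, hgz⟩ := key
      rcases le_or_gt |w.re| η with hle | hgt
      · have h3 : Q ≤ ‖z‖ ^ (-γ) := by
          rw [← hηQ]
          exact Real.rpow_le_rpow_of_nonpos hz0 (by linarith) (by linarith)
        have h4 : ‖f w‖ ≤ Real.exp |M| :=
          (hM w hwcl).trans ((le_abs_self M).trans (by linarith [Real.add_one_le_exp |M|]))
        calc ‖g w‖ * ‖f w‖ ≤ Real.exp (-K' * (c * ‖z‖ ^ (-γ))) * Real.exp |M| := by gcongr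
          _ = Real.exp (-K' * (c * ‖z‖ ^ (-γ)) + |M|) := (Real.exp_add _ _).symm
          _ ≤ Real.exp K := by
            apply Real.exp_le_exp.2
            have : K' * c * Q ≤ K' * c * ‖z‖ ^ (-γ) := by gcongr
            have h5 : K' * c * Q = |M| + K' * c := by rw [hQ]; field_simp
            have : 0 < K' * c := by positivity
            nlinarith
      · have hre0 : 0 < |w.re| := hη0.trans hgt
        have h3 : 2 ^ (-γ) * |w.re| ^ (-γ) ≤ ‖z‖ ^ (-γ) := by
          rw [← Real.mul_rpow (by norm_num) (abs_nonneg _)]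
          exact Real.rpow_le_rpow_of_nonpos hz0 (by linarith) (by linarith)
        have h4 := hb w (abs_pos.1 hre0) hx1 hy1
        calc ‖g w‖ * ‖f w‖ ≤ Real.exp (-K' * (c * ‖z‖ ^ (-γ))) * Real.exp (K * |w.re| ^ (-γ)) := by
              gcongr
          _ = Real.exp (-K' * (c * ‖z‖ ^ (-γ)) + K * |w.re| ^ (-γ)) := (Real.exp_add _ _).symm
          _ ≤ Real.exp K := by
            apply Real.exp_le_exp.2
            have h5 : K' * c * (2 ^ (-γ) * |w.re| ^ (-γ)) ≤ K' * c * ‖z‖ ^ (-γ) := by gcongr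
            have h6 : K' * c * (2 ^ (-γ) * |w.re| ^ (-γ)) = K * |w.re| ^ (-γ) := by
              rw [hK', Real.rpow_neg (by norm_num : (0 : ℝ) ≤ 2)]; field_simp
            nlinarith
    · obtain ⟨hwre, -⟩ := hw
      have hre : |w.re| = 1 := by
        rcases hwre with hi | hi
        · rw [hi]; norm_num
        · rw [Set.mem_singleton_iff.1 hi]; norm_num
      have h4 := hb w (abs_pos.1 (by rw [hre]; norm_num)) hx1 hy1
      rw [hre, Real.one_rpow, mul_one] at h4
      have h5 : ‖g w‖ ≤ 1 := by
        rw [hgn, Real.exp_le_one_iff]; nlinarith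
      calc ‖g w‖ * ‖f w‖ ≤ 1 * Real.exp K := by gcongr
        _ = _ := one_mul _
  have hmax := Complex.norm_le_of_forall_mem_frontier_norm_le hbdd
    (f := fun w => g w • f w) (DifferentiableOn.diffContOnCl fun w hw =>
      ((hgd w (hcl' w hw).2).smul (hd w (hcl' w hw).1 (hcl' w hw).2)).differentiableWithinAt) hfr
    (z := (x : ℂ)) (by
      rw [hcl, Complex.mem_reProdIm]
      exact ⟨abs_le.1 hx, by simp⟩)
  have hgx : Real.exp (-(2 * K')) ≤ ‖g x‖ := by
    rw [hgn]
    have hle : ∀ z : ℂ, 1 ≤ z.re → (z ^ (-γ : ℂ)).re ≤ 1 := fun z hz => by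
      have hz1 : 1 ≤ ‖z‖ := hz.trans (Complex.re_le_norm z)
      refine (Complex.re_le_norm _).trans ?_
      rw [← Complex.ofReal_neg, Complex.norm_cpow_real]
      exact Real.rpow_le_one_of_one_le_of_nonpos hz1 (by linarith)
    apply Real.exp_le_exp.2
    have e1 := hle (1 + (η : ℂ) + I * x) (by rw [hre1]; simp [hη0.le])
    have e2 := hle (1 + (η : ℂ) - I * x) (by rw [hre2]; simp [hη0.le])
    nlinarith
  rw [norm_smul] at hmax
  have h7 : Real.exp (-(2 * K')) * ‖f x‖ ≤ Real.exp K :=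
    (mul_le_mul_of_nonneg_right hgx (norm_nonneg _)).trans hmax
  rw [Real.exp_neg, inv_mul_le_iff₀ (Real.exp_pos _), ← Real.exp_add] at h7
  refine h7.trans (le_of_eq ?_)
  congr 1
  rw [hK']; ring

/-- The sum over `i ∈ s` of `κᵢ b̄ᵢ ^ j / (1 + δᵢ - b̄ᵢ z) ^ (j + 1)`. -/
def poleSum {ι : Type*} (s : Finset ι) (κ δ : ι → ℝ) (b : ι → ℂ) (j : ℕ) (z : ℂ) : ℂ :=
  ∑ i ∈ s, (κ i : ℂ) * (starRingEnd ℂ (b i)) ^ j / (1 + δ i - starRingEnd ℂ (b i) * z) ^ (j + 1)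

section PoleSum

variable {ι : Type*} {s : Finset ι} {κ δ : ι → ℝ} {b : ι → ℂ} {z : ℂ}

theorem le_re_one_add_sub {r d : ℝ} {a z : ℂ} (ha : ‖a‖ = 1) (hz : ‖z‖ ≤ r) :
    1 + d - r ≤ (1 + d - starRingEnd ℂ a * z).re := by
  have h : (starRingEnd ℂ a * z).re ≤ r := by
    refine (Complex.re_le_norm _).trans ?_
    rwa [norm_mul, RCLike.norm_conj, ha, one_mul]
  simp only [Complex.sub_re, Complex.add_re, Complex.one_re, Complex.ofReal_re]
  linarith

theorem norm_one_sub_conj_mul {a z : ℂ} (ha : ‖a‖ = 1) :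
    ‖1 - starRingEnd ℂ a * z‖ = ‖z - a‖ := by
  have h : starRingEnd ℂ a * a = 1 := by rw [Complex.conj_mul', ha]; norm_num
  rw [← h, ← mul_sub, norm_mul, RCLike.norm_conj, ha, one_mul, norm_sub_rev]

theorem hasDerivAt_poleSum (h : ∀ i ∈ s, (1 + δ i - starRingEnd ℂ (b i) * z : ℂ) ≠ 0) (j : ℕ) :
    HasDerivAt (poleSum s κ δ b j) ((j + 1) * poleSum s κ δ b (j + 1) z) z := by
  unfold poleSum
  rw [Finset.mul_sum]
  refine HasDerivAt.fun_sum fun i hi => ?_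
  have h1 : HasDerivAt (fun z : ℂ => 1 + (δ i : ℂ) - starRingEnd ℂ (b i) * z)
      (-(starRingEnd ℂ (b i))) z := by
    simpa using ((hasDerivAt_id z).const_mul (starRingEnd ℂ (b i))).const_sub (1 + (δ i : ℂ))
  have h2 := ((h1.pow (j + 1)).inv (pow_ne_zero _ (h i hi))).const_mul
    ((κ i : ℂ) * (starRingEnd ℂ (b i)) ^ j)
  simp only [div_eq_mul_inv]
  refine h2.congr_deriv ?_
  have := h i hi
  simp only [Pi.pow_apply, Nat.add_sub_cancel]
  field_simp
  push_cast
  ring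

theorem norm_poleSum_le {ρ K : ℝ} (hρ : 0 < ρ) (hκ : ∀ i ∈ s, 0 ≤ κ i) (hb : ∀ i ∈ s, ‖b i‖ = 1)
    (hK : ∑ i ∈ s, κ i ≤ K) (h : ∀ i ∈ s, ρ ≤ ‖(1 + δ i - starRingEnd ℂ (b i) * z : ℂ)‖) (j : ℕ) :
    ‖poleSum s κ δ b j z‖ ≤ K / ρ ^ (j + 1) := by
  unfold poleSum
  calc _ ≤ ∑ i ∈ s, κ i / ρ ^ (j + 1) := by
        refine norm_sum_le_of_le _ fun i hi => ?_
        rw [norm_div, norm_mul, norm_pow, norm_pow, RCLike.norm_conj, hb i hi, one_pow, mul_one,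
          Complex.norm_real, Real.norm_of_nonneg (hκ i hi)]
        have := hκ i hi
        gcongr
        exact h i hi
    _ ≤ _ := by rw [← Finset.sum_div]; gcongr

theorem re_poleSum_term (i : ι) :
    ((κ i : ℂ) * (starRingEnd ℂ (b i)) ^ 0 / (1 + δ i - starRingEnd ℂ (b i) * z) ^ (0 + 1)).re =
      κ i * ((1 + δ i - starRingEnd ℂ (b i) * z).re / ‖1 + δ i - starRingEnd ℂ (b i) * z‖ ^ 2) := by
  rw [pow_zero, mul_one, zero_add, pow_one, div_eq_mul_inv, Complex.re_ofReal_mul, Complex.inv_re,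
    Complex.normSq_eq_norm_sq]

theorem re_poleSum_nonneg (hκ : ∀ i ∈ s, 0 ≤ κ i)
    (h : ∀ i ∈ s, 0 ≤ (1 + δ i - starRingEnd ℂ (b i) * z : ℂ).re) :
    0 ≤ (poleSum s κ δ b 0 z).re := by
  rw [poleSum, Complex.re_sum]
  refine Finset.sum_nonneg fun i hi => ?_
  rw [re_poleSum_term]
  exact mul_nonneg (hκ i hi) (div_nonneg (h i hi) (by positivity))

theorem le_re_poleSum (hκ : ∀ i ∈ s, 0 ≤ κ i)
    (h : ∀ i ∈ s, 0 ≤ (1 + δ i - starRingEnd ℂ (b i) * z : ℂ).re) {i : ι} (hi : i ∈ s) {r R : ℝ}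
    (hr : 0 < r) (h1 : r ≤ (1 + δ i - starRingEnd ℂ (b i) * z : ℂ).re)
    (h2 : ‖(1 + δ i - starRingEnd ℂ (b i) * z : ℂ)‖ ≤ R) :
    κ i * (r / R ^ 2) ≤ (poleSum s κ δ b 0 z).re := by
  rw [poleSum, Complex.re_sum]
  have hn : 0 < ‖(1 + δ i - starRingEnd ℂ (b i) * z : ℂ)‖ :=
    hr.trans_le (h1.trans (Complex.re_le_norm _))
  refine le_trans ?_ (Finset.single_le_sum (fun j hj => ?_) hi)
  · rw [re_poleSum_term]
    have := hκ i hi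
    have := h i hi
    gcongr
  · rw [re_poleSum_term]
    exact mul_nonneg (hκ j hj) (div_nonneg (h j hj) (by positivity))

theorem norm_exp_neg_poleSum : ‖exp (-poleSum s κ δ b 0 z)‖ =
    Real.exp (-(poleSum s κ δ b 0 z).re) := by
  rw [Complex.norm_exp, Complex.neg_re]

theorem hasDerivAt_exp_neg_poleSum
    (h : ∀ i ∈ s, (1 + δ i - starRingEnd ℂ (b i) * z : ℂ) ≠ 0) :
    HasDerivAt (fun z => exp (-poleSum s κ δ b 0 z))
      (-(exp (-poleSum s κ δ b 0 z) * poleSum s κ δ b 1 z)) z := by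
  have := (hasDerivAt_poleSum (κ := κ) h 0).neg.cexp
  simpa using this

theorem norm_deriv_deriv_exp_neg_poleSum_le {ρ K M : ℝ} (hρ : 0 < ρ) (hK0 : 0 ≤ K)
    (hκ : ∀ i ∈ s, 0 ≤ κ i) (hb : ∀ i ∈ s, ‖b i‖ = 1) (hK : ∑ i ∈ s, κ i ≤ K)
    (h : ∀ i ∈ s, ρ ≤ ‖(1 + δ i - starRingEnd ℂ (b i) * z : ℂ)‖)
    (hM : M ≤ (poleSum s κ δ b 0 z).re) :
    ‖deriv (deriv fun z => exp (-poleSum s κ δ b 0 z)) z‖ ≤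
      ((K / ρ ^ 2) ^ 2 + 2 * (K / ρ ^ 3)) * Real.exp (-M) := by
  have hne : ∀ i ∈ s, (1 + δ i - starRingEnd ℂ (b i) * z : ℂ) ≠ 0 := fun i hi =>
    norm_pos_iff.1 (hρ.trans_le (h i hi))
  have hev : ∀ᶠ w in nhds z, ∀ i ∈ s, (1 + δ i - starRingEnd ℂ (b i) * w : ℂ) ≠ 0 := by
    rw [Filter.eventually_all_finset]
    intro i hi
    have : ContinuousAt (fun w : ℂ => (1 + δ i - starRingEnd ℂ (b i) * w : ℂ)) z := by fun_prop
    exact this.eventually_ne (hne i hi)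
  have hd : deriv (fun z => exp (-poleSum s κ δ b 0 z)) =ᶠ[nhds z]
      fun z => -(exp (-poleSum s κ δ b 0 z) * poleSum s κ δ b 1 z) :=
    hev.mono fun w hw => (hasDerivAt_exp_neg_poleSum hw).deriv
  have h2 := ((hasDerivAt_exp_neg_poleSum (κ := κ) hne).mul
    (hasDerivAt_poleSum (κ := κ) hne 1)).neg.deriv
  rw [hd.deriv_eq]
  have e : deriv (fun z => -(exp (-poleSum s κ δ b 0 z) * poleSum s κ δ b 1 z)) z =
      (poleSum s κ δ b 1 z ^ 2 - 2 * poleSum s κ δ b 2 z) * exp (-poleSum s κ δ b 0 z) := by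
    refine Eq.trans h2 ?_
    push_cast
    ring
  rw [e, norm_mul, norm_exp_neg_poleSum]
  have b1 := norm_poleSum_le hρ hκ hb hK h 1
  have b2 := norm_poleSum_le hρ hκ hb hK h 2
  gcongr
  refine (norm_sub_le _ _).trans ?_
  rw [norm_pow, norm_mul]
  norm_num at b1 b2 ⊢
  gcongr

end PoleSum

/-- The point `exp (2πi m / p ^ N)`, where `i = ⟨N, m⟩`. -/
def cantorNode (p : ℕ) (i : (_ : ℕ) × ℕ) : ℂ :=
  exp (2 * Real.pi * I * ((i.2 / (p : ℝ) ^ i.1 : ℝ) : ℂ))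

theorem norm_cantorNode (p : ℕ) (i : (_ : ℕ) × ℕ) : ‖cantorNode p i‖ = 1 := by
  rw [cantorNode, show ∀ x : ℝ, 2 * Real.pi * I * (x : ℂ) = ((2 * Real.pi * x : ℝ) : ℂ) * I from
    fun x => by push_cast; ring]
  exact Complex.norm_exp_ofReal_mul_I _

theorem sum_sigma_cantorNum_le {p : ℕ} {κ : ℝ} (h0 : 0 ≤ κ) (h1 : 2 * κ < 1) (n : ℕ) :
    ∑ i ∈ (Finset.range n).sigma (cantorNum p), κ ^ i.1 ≤ (1 - 2 * κ)⁻¹ := by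
  rw [Finset.sum_sigma]
  calc _ ≤ ∑ N ∈ Finset.range n, (2 * κ) ^ N := by
        refine Finset.sum_le_sum fun N _ => ?_
        dsimp only
        rw [Finset.sum_const, nsmul_eq_mul, mul_pow]
        gcongr
        exact_mod_cast card_cantorNum_le p N
    _ ≤ ∑' N, (2 * κ) ^ N :=
        (summable_geometric_of_lt_one (by positivity) h1).sum_le_tsum _ fun _ _ => by positivity
    _ = _ := tsum_geometric_of_lt_one (by positivity) h1

theorem exists_pow_mul_exp_neg_rpow_le {β c : ℝ} (hβ : 0 < β) (hc : 0 < c) (j : ℕ) :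
    ∃ C : ℝ, 0 ≤ C ∧ ∀ t : ℝ, 1 ≤ t → t ^ j * Real.exp (-(c * t ^ β)) ≤ C := by
  obtain ⟨m, hm⟩ := exists_nat_ge (j / β)
  refine ⟨m.factorial / c ^ m, by positivity, fun t ht => ?_⟩
  have ht0 : 0 < t := by linarith
  have h1 : t ^ j ≤ (t ^ β) ^ m := by
    rw [← Real.rpow_natCast, ← Real.rpow_natCast, ← Real.rpow_mul ht0.le]
    apply Real.rpow_le_rpow_of_exponent_le ht
    rw [div_le_iff₀ hβ] at hm
    linarith
  have h2 := Real.pow_div_factorial_le_exp (x := c * t ^ β) (by positivity) m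
  rw [Real.exp_neg, ← div_eq_mul_inv, div_le_div_iff₀ (Real.exp_pos _) (by positivity)]
  rw [div_le_iff₀ (by positivity), mul_pow] at h2
  nlinarith [pow_pos hc m]

/-- Bounded holomorphic multipliers, uniformly twice differentiable on the closed disk, which are
very small near the `n`-th stage of the Cantor set. -/
theorem exists_multiplier {p : ℕ} (hp : 3 ≤ p) {β : ℝ} (hβ0 : 0 < β)
    (hβ1 : 2 * (p : ℝ) ^ (β - 1) < 1) :
    ∃ L c : ℝ, 0 < c ∧ ∀ n : ℕ, ∃ f : ℂ → ℂ,
      DifferentiableOn ℂ f (ball 0 (1 + 4 / (p : ℝ) ^ n)) ∧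
      (∀ z : ℂ, ‖z‖ ≤ 1 + 2 / (p : ℝ) ^ n → ‖f z‖ ≤ 1) ∧ c ≤ ‖f 0‖ ∧
      (∀ z : ℂ, ‖z‖ ≤ 1 → ‖deriv (deriv f) z‖ ≤ L) ∧
      ∀ z : ℂ, ‖z‖ ≤ 1 + 2 / (p : ℝ) ^ n → ∀ m ∈ cantorNum p n,
        ‖z - exp (2 * Real.pi * I * ((m / (p : ℝ) ^ n : ℝ) : ℂ))‖ ≤ 16 / (p : ℝ) ^ n →
        ‖f z‖ ≤ Real.exp (-(((p : ℝ) ^ n) ^ β / 200)) := by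
  have hp0 : (0 : ℝ) < p := by positivity
  have hp1 : (1 : ℝ) ≤ p := by exact_mod_cast (by omega : 1 ≤ p)
  set κ : ℝ := (p : ℝ) ^ (β - 1) with hκ
  have hκ0 : 0 < κ := by positivity
  have hκpow : ∀ k : ℕ, κ ^ k * (p : ℝ) ^ k = ((p : ℝ) ^ k) ^ β := fun k => by
    rw [← mul_pow, hκ, Real.rpow_sub_one hp0.ne', div_mul_cancel₀ _ hp0.ne',
      Real.rpow_pow_comm hp0.le]
  set K := (1 - 2 * κ)⁻¹ with hK
  have hK0 : 0 < K := inv_pos.2 (by linarith)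
  obtain ⟨C, hC0, hC⟩ := exists_pow_mul_exp_neg_rpow_le hβ0 (show (0 : ℝ) < 1 / 100 by norm_num) 4
  refine ⟨(K ^ 2 + 2 * K) * (p : ℝ) ^ 4 * C, Real.exp (-K), Real.exp_pos _, fun n => ?_⟩
  set s := (Finset.range (n + 1)).sigma (cantorNum p) with hs
  set w : (_ : ℕ) × ℕ → ℝ := fun i => κ ^ i.1 with hw
  set δ : (_ : ℕ) × ℕ → ℝ := fun i => 4 / (p : ℝ) ^ i.1 with hδ
  have hmem : ∀ i : (_ : ℕ) × ℕ, i ∈ s ↔ i.1 ≤ n ∧ i.2 ∈ cantorNum p i.1 := fun i => by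
    rw [hs, Finset.mem_sigma, Finset.mem_range, Nat.lt_succ_iff]
  have hw0 : ∀ i ∈ s, 0 ≤ w i := fun i _ => by positivity
  have hwK : ∑ i ∈ s, w i ≤ K := sum_sigma_cantorNum_le hκ0.le hβ1 _
  have hb : ∀ i ∈ s, ‖cantorNode p i‖ = 1 := fun i _ => norm_cantorNode p i
  have hδmono : ∀ N k : ℕ, N ≤ k → 4 / (p : ℝ) ^ k ≤ 4 / (p : ℝ) ^ N := fun N k h => by gcongr
  have hδn : ∀ i ∈ s, 4 / (p : ℝ) ^ n ≤ δ i := fun i hi => hδmono _ _ ((hmem i).1 hi).1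
  have hδpos : ∀ k : ℕ, 0 < 4 / (p : ℝ) ^ k := fun k => by positivity
  have hre : ∀ z : ℂ, ∀ r : ℝ, ‖z‖ ≤ r → ∀ i, 1 + δ i - r ≤
      (1 + δ i - starRingEnd ℂ (cantorNode p i) * z).re := fun z r hz i =>
    le_re_one_add_sub (norm_cantorNode p i) hz
  have hden : ∀ z : ℂ, ∀ i, ‖(1 + δ i - starRingEnd ℂ (cantorNode p i) * z : ℂ)‖ ≤
      δ i + ‖z - cantorNode p i‖ := fun z i => by
    rw [← norm_one_sub_conj_mul (norm_cantorNode p i)]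
    have : ‖(δ i : ℂ)‖ = δ i := by rw [Complex.norm_real, Real.norm_of_nonneg (hδpos _).le]
    nth_rewrite 2 [← this]
    refine le_trans (le_of_eq ?_) (norm_add_le _ _)
    congr 1; ring
  have hre0 : ∀ z : ℂ, ‖z‖ ≤ 1 + 2 / (p : ℝ) ^ n → ∀ i ∈ s,
      0 ≤ (1 + δ i - starRingEnd ℂ (cantorNode p i) * z).re := fun z hz i hi => by
    have h1 := hre z _ hz i
    have h2 := hδn i hi
    have h3 : 4 / (p : ℝ) ^ n = 2 * (2 / (p : ℝ) ^ n) := by ring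
    have h4 : 0 < 2 / (p : ℝ) ^ n := by positivity
    linarith
  refine ⟨fun z => exp (-poleSum s w δ (cantorNode p) 0 z), ?_, ?_, ?_, ?_, ?_⟩
  · intro z hz
    refine (hasDerivAt_exp_neg_poleSum fun i hi h => ?_).differentiableAt.differentiableWithinAt
    have h1 := hre z _ le_rfl i
    rw [h, Complex.zero_re] at h1
    have h2 : ‖z‖ < 1 + 4 / (p : ℝ) ^ n := by simpa using hz
    linarith [hδn i hi]
  · intro z hz
    rw [norm_exp_neg_poleSum, Real.exp_le_one_iff]
    linarith [re_poleSum_nonneg hw0 (hre0 z hz)]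
  · rw [norm_exp_neg_poleSum, Real.exp_le_exp, neg_le_neg_iff]
    refine (Complex.re_le_norm _).trans ?_
    have := norm_poleSum_le (z := 0) one_pos hw0 hb hwK (fun i hi => ?_) 0 (δ := δ)
    · simpa using this
    · refine le_trans ?_ (Complex.re_le_norm _)
      have : 0 ≤ δ i := (hδpos _).le
      simpa using this
  · intro z hz
    have hz2 : ‖z‖ ≤ 1 + 2 / (p : ℝ) ^ n := by
      have : 0 < 2 / (p : ℝ) ^ n := by positivity
      linarith
    have hre1 : ∀ i, δ i ≤ (1 + δ i - starRingEnd ℂ (cantorNode p i) * z).re := fun i => by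
      linarith [hre z 1 hz i]
    set P : ℕ → Prop := fun k =>
      ∃ m ∈ cantorNum p k, ‖z - cantorNode p ⟨k, m⟩‖ ≤ 4 * (4 / (p : ℝ) ^ k)
    have hP0 : P 0 := ⟨0, by simp [cantorNum], by
      refine (norm_sub_le _ _).trans ?_
      rw [norm_cantorNode]; norm_num; linarith⟩
    obtain ⟨k, hkn, ⟨m, hm, hzm⟩, hmax⟩ : ∃ k ≤ n, P k ∧ ∀ j, k < j → j ≤ n → ¬ P j := by
      classical
      refine ⟨Nat.findGreatest P n, Nat.findGreatest_le n,
        Nat.findGreatest_spec (Nat.zero_le n) hP0, fun j hj hjn => ?_⟩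
      exact Nat.findGreatest_is_greatest hj hjn
    have hM : ((p : ℝ) ^ k) ^ β / 100 ≤ (poleSum s w δ (cantorNode p) 0 z).re := by
      have := le_re_poleSum hw0 (hre0 z hz2) ((hmem ⟨k, m⟩).2 ⟨hkn, hm⟩) (hδpos k) (hre1 ⟨k, m⟩)
        ((hden z ⟨k, m⟩).trans (add_le_add le_rfl hzm))
      refine le_trans (le_of_eq ?_) this
      simp only [hw, hδ]
      rw [← hκpow]
      field_simp
      norm_num
    have hρ : ∀ i ∈ s, 4 / (p : ℝ) ^ (k + 1) ≤
        ‖(1 + δ i - starRingEnd ℂ (cantorNode p i) * z : ℂ)‖ := by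
      rintro ⟨N, m'⟩ hi
      obtain ⟨hNn, hm'⟩ := (hmem _).1 hi
      dsimp only at hNn hm'
      rcases Nat.lt_or_ge k N with hkN | hNk
      · obtain ⟨l, hl, hl1, hl2⟩ := cantorNum_ancestor (by omega) (show k + 1 ≤ N from hkN) hm'
        have hnot := hmax (k + 1) (by omega) (by omega)
        have h1 : 4 * (4 / (p : ℝ) ^ (k + 1)) < ‖z - cantorNode p ⟨k + 1, l⟩‖ := by
          by_contra! h
          exact hnot ⟨l, hl, h⟩
        have h2 : ‖cantorNode p ⟨N, m'⟩ - cantorNode p ⟨k + 1, l⟩‖ ≤ 8 / (p : ℝ) ^ (k + 1) := by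
          refine (norm_exp_two_pi_sub_le _ _).trans ?_
          dsimp only
          have hN0 : 0 < 1 / (p : ℝ) ^ N := by positivity
          rw [abs_of_nonneg (by linarith)]
          have h3 : (m' : ℝ) / (p : ℝ) ^ N - l / (p : ℝ) ^ (k + 1) ≤ 1 / (p : ℝ) ^ (k + 1) := by
            linarith
          have : 2 * Real.pi ≤ 8 := by linarith [Real.pi_lt_four]
          calc _ ≤ 8 * (1 / (p : ℝ) ^ (k + 1)) := by gcongr
            _ = _ := by ring
        have h3 : ‖z - cantorNode p ⟨k + 1, l⟩‖ ≤ ‖z - cantorNode p ⟨N, m'⟩‖ +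
            ‖cantorNode p ⟨N, m'⟩ - cantorNode p ⟨k + 1, l⟩‖ :=
          norm_sub_le_norm_sub_add_norm_sub _ _ _
        have h4 : ‖z - cantorNode p ⟨N, m'⟩‖ ≤
            ‖(1 + δ ⟨N, m'⟩ - starRingEnd ℂ (cantorNode p ⟨N, m'⟩) * z : ℂ)‖ := by
          rw [← norm_one_sub_conj_mul (norm_cantorNode p _)]
          have hr := hre z 1 hz ⟨N, m'⟩
          have hd := hδpos N
          rw [Complex.norm_eq_sqrt_sq_add_sq, Complex.norm_eq_sqrt_sq_add_sq]
          simp only [Complex.sub_re, Complex.add_re, Complex.one_re, Complex.ofReal_re,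
            Complex.sub_im, Complex.add_im, Complex.one_im, Complex.ofReal_im] at hr ⊢
          apply Real.sqrt_le_sqrt
          have hδe : δ ⟨N, m'⟩ = 4 / (p : ℝ) ^ N := rfl
          rw [hδe] at hr ⊢
          simp only [add_zero]
          nlinarith
        have h5 : 4 * (4 / (p : ℝ) ^ (k + 1)) = 4 / (p : ℝ) ^ (k + 1) + 8 / (p : ℝ) ^ (k + 1) +
            4 / (p : ℝ) ^ (k + 1) := by ring
        have h6 := hδpos (k + 1)
        linarith
      · exact (hδmono N (k + 1) (by omega)).trans ((hre1 ⟨N, m'⟩).trans (Complex.re_le_norm _))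
    have hpk : (1 : ℝ) ≤ (p : ℝ) ^ k := one_le_pow₀ hp1
    have hpk1 : (1 : ℝ) ≤ (p : ℝ) ^ (k + 1) := one_le_pow₀ hp1
    refine (norm_deriv_deriv_exp_neg_poleSum_le (hδpos (k + 1)) hK0.le hw0 hb hwK hρ hM).trans ?_
    have e1 : K / (4 / (p : ℝ) ^ (k + 1)) ^ 2 ≤ K * ((p : ℝ) ^ (k + 1)) ^ 2 := by
      rw [div_pow, div_div_eq_mul_div]
      refine div_le_of_le_mul₀ (by positivity) (by positivity) ?_
      nlinarith [show 0 < K * ((p : ℝ) ^ (k + 1)) ^ 2 by positivity]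
    have e2 : K / (4 / (p : ℝ) ^ (k + 1)) ^ 3 ≤ K * ((p : ℝ) ^ (k + 1)) ^ 3 := by
      rw [div_pow, div_div_eq_mul_div]
      refine div_le_of_le_mul₀ (by positivity) (by positivity) ?_
      nlinarith [show 0 < K * ((p : ℝ) ^ (k + 1)) ^ 3 by positivity]
    have e3 := hC _ hpk
    calc _ ≤ ((K * ((p : ℝ) ^ (k + 1)) ^ 2) ^ 2 + 2 * (K * ((p : ℝ) ^ (k + 1)) ^ 4)) *
          Real.exp (-(((p : ℝ) ^ k) ^ β / 100)) := by
          gcongr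
          refine e2.trans ?_
          gcongr
          norm_num
      _ = (K ^ 2 + 2 * K) * (p : ℝ) ^ 4 *
          (((p : ℝ) ^ k) ^ 4 * Real.exp (-(1 / 100 * ((p : ℝ) ^ k) ^ β))) := by
          rw [one_div_mul_eq_div]; ring
      _ ≤ _ := by gcongr
  · intro z hz m hm hzm
    rw [norm_exp_neg_poleSum, Real.exp_le_exp, neg_le_neg_iff]
    have hq : 0 < 2 / (p : ℝ) ^ n := by positivity
    have := le_re_poleSum hw0 (hre0 z hz) ((hmem ⟨n, m⟩).2 ⟨le_rfl, hm⟩) hq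
      (le_trans (by
          simp only [hδ]
          rw [show 4 / (p : ℝ) ^ n = 2 * (2 / (p : ℝ) ^ n) by ring]
          linarith)
        (hre z _ hz ⟨n, m⟩)) ((hden z ⟨n, m⟩).trans (add_le_add le_rfl hzm))
    refine le_trans (le_of_eq ?_) this
    simp only [hw, hδ]
    rw [← hκpow]
    field_simp
    norm_num

/-- The integral of `g` along the boundary of the rectangle `[a, b] × [c, d]`. -/
def rectIntegral {F : Type*} [NormedAddCommGroup F] [NormedSpace ℂ F] (g : ℂ → F)
    (a b c d : ℝ) : F :=
  (∫ x in a..b, g (x + c * I)) - (∫ x in a..b, g (x + d * I)) +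
    I • (∫ y in c..d, g (b + y * I)) - I • ∫ y in c..d, g (a + y * I)

section Rect

variable {F : Type*} [NormedAddCommGroup F] [NormedSpace ℂ F]

theorem rectIntegral_eq_zero [CompleteSpace F] {g : ℂ → F} {a b c d : ℝ} (hab : a ≤ b)
    (hcd : c ≤ d)
    (h : ∀ w : ℂ, w.re ∈ Icc a b → w.im ∈ Icc c d → DifferentiableAt ℂ g w) :
    rectIntegral g a b c d = 0 := by
  have := Complex.integral_boundary_rect_eq_zero_of_differentiableOn g (a + c * I) (b + d * I)
    (fun w hw => by
      simp only [Complex.add_re, Complex.ofReal_re, Complex.mul_re, Complex.I_re, mul_zero,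
        Complex.ofReal_im, Complex.I_im, mul_one, sub_self, add_zero, Complex.add_im,
        Complex.mul_im, zero_add, Complex.mem_reProdIm, uIcc_of_le hab, uIcc_of_le hcd] at hw
      exact (h w hw.1 hw.2).differentiableWithinAt)
  simpa [rectIntegral] using this

theorem norm_rectIntegral_le {g : ℂ → F} {a b c d ε : ℝ} (hab : a ≤ b) (hcd : c ≤ d)
    (hh : ∀ x ∈ Icc a b, ‖g (x + c * I)‖ ≤ ε ∧ ‖g (x + d * I)‖ ≤ ε)
    (hv : ∀ y ∈ Icc c d, ‖g (a + y * I)‖ ≤ ε ∧ ‖g (b + y * I)‖ ≤ ε) :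
    ‖rectIntegral g a b c d‖ ≤ ε * (2 * (b - a) + 2 * (d - c)) := by
  have key : ∀ (k : ℝ → F) (s t : ℝ), s ≤ t → (∀ x ∈ Icc s t, ‖k x‖ ≤ ε) →
      ‖∫ x in s..t, k x‖ ≤ ε * (t - s) := fun k s t hst hk => by
    have := intervalIntegral.norm_integral_le_of_norm_le_const (a := s) (b := t) (f := k) (C := ε)
      fun x hx => hk x (by rw [uIoc_of_le hst] at hx; exact Ioc_subset_Icc_self hx)
    rwa [abs_of_nonneg (by linarith)] at this
  have h1 := key (fun x => g (x + c * I)) a b hab fun x hx => (hh x hx).1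
  have h2 := key (fun x => g (x + d * I)) a b hab fun x hx => (hh x hx).2
  have h3 := key (fun y => g (a + y * I)) c d hcd fun x hx => (hv x hx).1
  have h4 := key (fun y => g (b + y * I)) c d hcd fun x hx => (hv x hx).2
  unfold rectIntegral
  refine (norm_sub_le _ _).trans ?_
  refine (add_le_add (norm_add_le _ _) le_rfl).trans ?_
  refine (add_le_add (add_le_add (norm_sub_le _ _) le_rfl) le_rfl).trans ?_
  rw [norm_smul, norm_smul, Complex.norm_I, one_mul, one_mul]
  linarith

/-- For a `2πi`-periodic function, the difference of the integrals along two vertical segments of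
length `2π` is controlled by the integrals along the boundaries of the intermediate cells. -/
theorem norm_integral_sub_integral_le_of_periodic {g : ℂ → F} {a b : ℝ}
    (hper : ∀ w, g (w + 2 * Real.pi * I) = g w)
    (ha : Continuous fun y : ℝ => g (a + y * I)) (hb : Continuous fun y : ℝ => g (b + y * I))
    {y : ℕ → ℝ} {q : ℕ} (hy : y q = y 0 + 2 * Real.pi) {C : ℝ}
    (hC : ∀ j < q, ‖rectIntegral g a b (y j) (y (j + 1))‖ ≤ C) :
    ‖(∫ t in (0 : ℝ)..2 * Real.pi, g (b + t * I)) - ∫ t in (0 : ℝ)..2 * Real.pi, g (a + t * I)‖ ≤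
      q * C := by
  have hv : ∀ c : ℝ, Continuous (fun y : ℝ => g (c + y * I)) →
      ∑ j ∈ Finset.range q, ∫ t in y j..y (j + 1), g (c + t * I) =
        ∫ t in (0 : ℝ)..2 * Real.pi, g (c + t * I) := fun c hc => by
    rw [intervalIntegral.sum_integral_adjacent_intervals fun k _ => hc.intervalIntegrable _ _, hy]
    have hp : Function.Periodic (fun t : ℝ => g (c + t * I)) (2 * Real.pi) := fun t => by
      simp only
      rw [← hper (c + t * I)]
      congr 1; push_cast; ring
    simpa using hp.intervalIntegral_add_eq (y 0) 0
  have hsum : ∑ j ∈ Finset.range q, rectIntegral g a b (y j) (y (j + 1)) =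
      I • ((∫ t in (0 : ℝ)..2 * Real.pi, g (b + t * I)) -
        ∫ t in (0 : ℝ)..2 * Real.pi, g (a + t * I)) := by
    simp only [rectIntegral]
    rw [Finset.sum_sub_distrib, Finset.sum_add_distrib, ← Finset.smul_sum,
      ← Finset.smul_sum, hv a ha,
      hv b hb, Finset.sum_range_sub' (fun j => ∫ x in a..b, g (x + (y j : ℝ) * I)), hy, smul_sub]
    have : ∀ x : ℝ, g (x + ((y 0 + 2 * Real.pi : ℝ) : ℂ) * I) = g (x + (y 0 : ℝ) * I) := fun x => by
      rw [← hper (x + (y 0 : ℝ) * I)]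
      congr 1; push_cast; ring
    simp only [this, sub_self, zero_add]
  have h1 : ‖∑ j ∈ Finset.range q, rectIntegral g a b (y j) (y (j + 1))‖ ≤ q * C := by
    refine (norm_sum_le_of_le _ fun j hj => hC j (Finset.mem_range.1 hj)).trans ?_
    simp
  rwa [hsum, norm_smul, Complex.norm_I, one_mul] at h1

end Rect

/-- The first Taylor coefficients of a bounded function with bounded second derivative have
uniformly bounded sum. -/
theorem sum_norm_iteratedDeriv_le {f : ℂ → ℂ} {ρ L : ℝ} (hρ : 1 < ρ)
    (hf : DifferentiableOn ℂ f (ball 0 ρ)) (h1 : ∀ z : ℂ, ‖z‖ ≤ 1 → ‖f z‖ ≤ 1)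
    (h2 : ∀ z : ℂ, ‖z‖ ≤ 1 → ‖deriv (deriv f) z‖ ≤ L) (m : ℕ) :
    ∑ k ∈ Finset.range m, ‖iteratedDeriv (k + 1) f 0‖ / (k + 1).factorial ≤ 1 + L := by
  have hL : 0 ≤ L := (norm_nonneg _).trans (h2 0 (by simp))
  have hsub : closure (ball (0 : ℂ) 1) ⊆ ball 0 ρ := by
    rw [closure_ball _ one_ne_zero]
    exact closedBall_subset_ball hρ
  have hd1 : DifferentiableOn ℂ (deriv f) (ball 0 ρ) := hf.deriv isOpen_ball
  have hd2 : DifferentiableOn ℂ (deriv (deriv f)) (ball 0 ρ) := hd1.deriv isOpen_ball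
  have hsph : ∀ z ∈ sphere (0 : ℂ) 1, ‖z‖ ≤ 1 := fun z hz => by simpa using hz.le
  have hfirst : ‖iteratedDeriv 1 f 0‖ ≤ 1 := by
    rw [iteratedDeriv_one]
    simpa using Complex.norm_deriv_le_of_forall_mem_sphere_norm_le one_pos
      (hf.mono hsub).diffContOnCl fun z hz => h1 z (hsph z hz)
  have hrest : ∀ k : ℕ, ‖iteratedDeriv (k + 2) f 0‖ / (k + 2).factorial ≤
      L * (1 / (k + 1) - 1 / ((k + 1 : ℕ) + 1)) := fun k => by
    have := Complex.norm_iteratedDeriv_le_of_forall_mem_sphere_norm_le k one_pos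
      (hd2.mono hsub).diffContOnCl fun z hz => h2 z (hsph z hz)
    rw [← iteratedDeriv_succ', ← iteratedDeriv_succ', one_pow, div_one] at this
    have h3 : (0 : ℝ) < (k.factorial : ℝ) := by positivity
    rw [Nat.factorial_succ, Nat.factorial_succ]
    push_cast
    rw [div_le_iff₀ (by positivity)]
    refine this.trans (le_of_eq ?_)
    field_simp
    ring
  rcases m with _ | m
  · simpa using by linarith
  rw [Finset.sum_range_succ']
  have hsum : ∑ k ∈ Finset.range m, ‖iteratedDeriv (k + 1 + 1) f 0‖ / (k + 1 + 1).factorial ≤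
      L := by
    refine (Finset.sum_le_sum fun k _ => hrest k).trans ?_
    rw [← Finset.mul_sum]
    have := Finset.sum_range_sub' (fun k : ℕ => 1 / ((k : ℝ) + 1)) m
    have hm : 0 ≤ 1 / ((m : ℝ) + 1) := by positivity
    rw [this, Nat.cast_zero, zero_add, div_one]
    nlinarith [mul_nonneg hL hm]
  have : ‖iteratedDeriv (0 + 1) f 0‖ / (0 + 1).factorial ≤ 1 := by simpa using hfirst
  linarith

theorem integral_exp_inv_pow_smul {F : Type*} [NormedAddCommGroup F] [NormedSpace ℂ F]
    [CompleteSpace F] {g : ℂ → F} {r ρ : ℝ} (hg : DifferentiableOn ℂ g (ball 0 ρ))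
    (hr : Real.exp r < ρ) (k : ℕ) :
    ∫ t in (0 : ℝ)..2 * Real.pi, (exp (r + t * I) ^ k)⁻¹ • g (exp (r + t * I)) =
      (2 * Real.pi / k.factorial : ℂ) • iteratedDeriv k g 0 := by
  have hR := Real.exp_pos r
  have hd : DiffContOnCl ℂ g (ball 0 (Real.exp r)) := by
    refine (hg.mono ?_).diffContOnCl
    rw [closure_ball _ hR.ne']
    exact closedBall_subset_ball hr
  have h := hd.circleIntegral_one_div_sub_center_pow_smul hR k
  rw [circleIntegral] at h
  have e : ∀ t : ℝ, circleMap 0 (Real.exp r) t = exp (r + t * I) := fun t => by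
    rw [circleMap, zero_add, Complex.exp_add, Complex.ofReal_exp]
  have e2 : ∀ t : ℝ, deriv (circleMap 0 (Real.exp r)) t •
      (1 / (circleMap 0 (Real.exp r) t - 0) ^ (k + 1)) • g (circleMap 0 (Real.exp r) t) =
      I • (exp (r + t * I) ^ k)⁻¹ • g (exp (r + t * I)) := fun t => by
    rw [deriv_circleMap, e, sub_zero, smul_smul, smul_smul]
    congr 1
    have := Complex.exp_ne_zero (r + t * I)
    field_simp
    ring
  simp only [e2] at h
  rw [intervalIntegral.integral_smul] at h
  have h3 : (2 * Real.pi * I / k.factorial : ℂ) • iteratedDeriv k g 0 =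
      I • (2 * Real.pi / k.factorial : ℂ) • iteratedDeriv k g 0 := by
    rw [smul_smul]; congr 1; ring
  rw [h3] at h
  exact (smul_right_injective F Complex.I_ne_zero) h

section Resolvent

variable {A : Type*} [NormedRing A] [NormedAlgebra ℂ A]

theorem differentiableAt_resolvent [CompleteSpace A] {a : A} {z : ℂ} (hz : z ∈ resolventSet ℂ a) :
    DifferentiableAt ℂ (resolvent a) z :=
  (spectrum.hasDerivAt_resolvent_const_left hz).differentiableAt

theorem resolvent_eq_sum_add {a : A} {z : ℂ} (hz : z ∈ resolventSet ℂ a) (h0 : z ≠ 0) (m : ℕ) :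
    resolvent a z = ∑ k ∈ Finset.range m, (z ^ (k + 1))⁻¹ • a ^ k +
      (z ^ m)⁻¹ • (a ^ m * resolvent a z) := by
  induction m with
  | zero => simp
  | succ m ih =>
    have h1 : (algebraMap ℂ A z - a) * resolvent a z = 1 := Ring.mul_inverse_cancel _ hz
    have h2 : z • resolvent a z = 1 + a * resolvent a z := by
      rw [sub_mul, ← Algebra.smul_def] at h1
      rw [← h1]; abel
    have h3 : a ^ m * resolvent a z = z⁻¹ • (a ^ m + a ^ (m + 1) * resolvent a z) := by
      rw [pow_succ, mul_assoc]
      nth_rewrite 2 [← mul_one (a ^ m)]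
      rw [← mul_add, ← h2, mul_smul_comm, smul_smul, inv_mul_cancel₀ h0, one_smul]
    rw [Finset.sum_range_succ, add_assoc, ← smul_add]
    nth_rewrite 1 [ih]
    congr 1
    rw [h3, smul_smul, ← mul_inv, ← pow_succ]

/-- The functional calculus integral on a circle outside the closed unit disk is controlled by the
Taylor coefficients. -/
theorem norm_integral_smul_resolvent_le [CompleteSpace A] [NormOneClass A] {a : A} (ha : ‖a‖ ≤ 1)
    {f : ℂ → ℂ} {r ρ S : ℝ} (hr : 0 < r) (hrρ : Real.exp r < ρ)
    (hf : DifferentiableOn ℂ f (ball 0 ρ))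
    (hS : ∀ m, ∑ k ∈ Finset.range m, ‖iteratedDeriv (k + 1) f 0‖ / (k + 1).factorial ≤ S) :
    ‖∫ t in (0 : ℝ)..2 * Real.pi, f (exp (r + t * I)) • resolvent a (exp (r + t * I))‖ ≤
      2 * Real.pi * S := by
  have hnorm : ∀ t : ℝ, ‖exp (r + t * I)‖ = Real.exp r := fun t => by
    rw [Complex.norm_exp]; simp
  have hrho : 1 < Real.exp r := Real.one_lt_exp_iff.2 hr
  have hres : ∀ t : ℝ, exp (r + t * I) ∈ resolventSet ℂ a := fun t => by
    by_contra h
    have h2 := spectrum.norm_le_norm_of_mem (𝕜 := ℂ) (a := a) (k := exp (r + t * I)) h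
    rw [hnorm] at h2
    linarith
  have hexpc : Continuous fun t : ℝ => exp (r + t * I) := by fun_prop
  have hfc : Continuous fun t : ℝ => f (exp (r + t * I)) := by
    refine continuous_iff_continuousAt.2 fun t => ?_
    have : DifferentiableAt ℂ f (exp (r + t * I)) :=
      hf.differentiableAt (isOpen_ball.mem_nhds (by rw [mem_ball_zero_iff, hnorm]; exact hrρ))
    exact ContinuousAt.comp (f := fun t : ℝ => exp (r + t * I)) this.continuousAt hexpc.continuousAt
  have hRc : Continuous fun t : ℝ => resolvent a (exp (r + t * I)) := by
    refine continuous_iff_continuousAt.2 fun t => ?_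
    exact ContinuousAt.comp (f := fun t : ℝ => exp (r + t * I))
      (differentiableAt_resolvent (hres t)).continuousAt hexpc.continuousAt
  have hpc : ∀ k : ℕ, Continuous fun t : ℝ => (exp (r + t * I) ^ k)⁻¹ := fun k =>
    (hexpc.pow k).inv₀ fun t => pow_ne_zero _ (Complex.exp_ne_zero _)
  obtain ⟨M, hM⟩ : ∃ M : ℝ, ∀ t ∈ Icc (0 : ℝ) (2 * Real.pi),
      ‖f (exp (r + t * I)) • resolvent a (exp (r + t * I))‖ ≤ M :=
    isCompact_Icc.exists_bound_of_continuousOn (hfc.smul hRc).continuousOn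
  have hpi := Real.pi_pos
  have key : ∀ m : ℕ,
      ‖∫ t in (0 : ℝ)..2 * Real.pi, f (exp (r + t * I)) • resolvent a (exp (r + t * I))‖ ≤
      2 * Real.pi * S + 2 * Real.pi * M * ((Real.exp r)⁻¹) ^ m := fun m => by
    have e : ∀ t : ℝ, f (exp (r + t * I)) • resolvent a (exp (r + t * I)) =
        ∑ k ∈ Finset.range m, ((exp (r + t * I) ^ (k + 1))⁻¹ • f (exp (r + t * I))) • a ^ k +
        (exp (r + t * I) ^ m)⁻¹ • (a ^ m * (f (exp (r + t * I)) • resolvent a (exp (r + t * I)))) :=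
      fun t => by
        nth_rewrite 1 [resolvent_eq_sum_add (hres t) (Complex.exp_ne_zero _) m]
        rw [smul_add, Finset.smul_sum]
        congr 1
        · refine Finset.sum_congr rfl fun k _ => ?_
          rw [smul_smul, smul_eq_mul, mul_comm]
        · rw [mul_smul_comm, smul_comm]
    rw [intervalIntegral.integral_congr fun t _ => e t]
    have hc1 : ∀ k : ℕ, Continuous fun t : ℝ =>
        ((exp (r + t * I) ^ (k + 1))⁻¹ • f (exp (r + t * I))) • a ^ k := fun k =>
      ((hpc _).smul hfc).smul continuous_const
    have hc2 : Continuous fun t : ℝ =>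
        (exp (r + t * I) ^ m)⁻¹ • (a ^ m * (f (exp (r + t * I)) • resolvent a (exp (r + t * I)))) :=
      (hpc _).smul (continuous_const.mul (hfc.smul hRc))
    rw [intervalIntegral.integral_add
      ((continuous_finsetSum _ fun k _ => hc1 k).intervalIntegrable _ _)
      (hc2.intervalIntegrable _ _),
      intervalIntegral.integral_finsetSum fun k _ => (hc1 k).intervalIntegrable _ _]
    refine (norm_add_le _ _).trans (add_le_add ?_ ?_)
    · refine (norm_sum_le _ _).trans (le_trans ?_
        (mul_le_mul_of_nonneg_left (hS m) (by positivity)))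
      rw [Finset.mul_sum]
      refine Finset.sum_le_sum fun k _ => ?_
      rw [intervalIntegral.integral_smul_const, integral_exp_inv_pow_smul hf hrρ (k + 1), norm_smul,
        norm_smul]
      have h1 : ‖(2 * Real.pi / (k + 1).factorial : ℂ)‖ = 2 * Real.pi / (k + 1).factorial := by
        rw [norm_div, norm_mul, Complex.norm_real, Complex.norm_natCast, Real.norm_of_nonneg hpi.le]
        simp
      have h2 : ‖a ^ k‖ ≤ 1 := (norm_pow_le _ _).trans (pow_le_one₀ (norm_nonneg _) ha)
      rw [h1]
      calc _ ≤ 2 * Real.pi / (k + 1).factorial * ‖iteratedDeriv (k + 1) f 0‖ * 1 := by gcongr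
        _ = _ := by ring
    · have := intervalIntegral.norm_integral_le_of_norm_le_const (a := 0) (b := 2 * Real.pi)
        (C := M * ((Real.exp r)⁻¹) ^ m) (f := fun t : ℝ =>
        (exp (r + t * I) ^ m)⁻¹ • (a ^ m * (f (exp (r + t * I)) • resolvent a (exp (r + t * I)))))
        fun t ht => ?_
      · refine this.trans (le_of_eq ?_)
        rw [sub_zero, abs_of_pos (by positivity)]
        ring
      · rw [uIoc_of_le (by positivity)] at ht
        rw [norm_smul, norm_inv, norm_pow, hnorm, ← inv_pow, mul_comm]
        have h2 : ‖a ^ m‖ ≤ 1 := (norm_pow_le _ _).trans (pow_le_one₀ (norm_nonneg _) ha)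
        have h3 := hM t (Ioc_subset_Icc_self ht)
        gcongr
        refine (norm_mul_le _ _).trans ?_
        calc _ ≤ 1 * M := by gcongr
          _ = M := one_mul M
  have hlim : Filter.Tendsto (fun m : ℕ => 2 * Real.pi * S +
      2 * Real.pi * M * ((Real.exp r)⁻¹) ^ m) Filter.atTop
      (nhds (2 * Real.pi * S + 2 * Real.pi * M * 0)) :=
    ((tendsto_pow_atTop_nhds_zero_of_lt_one (by positivity) (inv_lt_one_of_one_lt₀ hrho)).const_mul
      _).const_add _
  rw [mul_zero, add_zero] at hlim
  exact ge_of_tendsto' hlim key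

end Resolvent

theorem abs_exp_sub_one_le_of_abs_le {x q : ℝ} (hq : 1 ≤ q) (hx : |x| ≤ 1 / q) :
    |Real.exp x - 1| ≤ 2 / q := by
  have h1 : 1 / q ≤ 1 := (div_le_one (by positivity)).2 hq
  calc _ ≤ 2 * |x| := Real.abs_exp_sub_one_le (hx.trans h1)
    _ ≤ 2 * (1 / q) := by gcongr
    _ = 2 / q := by ring

theorem exp_eq_of_norm_exp_eq_one {w : ℂ} (h : ‖exp w‖ = 1) :
    exp w = exp (2 * Real.pi * I * ((w.im / (2 * Real.pi) : ℝ) : ℂ)) := by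
  have h0 : w.re = 0 := by
    rw [Complex.norm_exp] at h
    exact Real.exp_eq_one_iff _ |>.1 h
  congr 1
  have hpi : (Real.pi : ℂ) ≠ 0 := by exact_mod_cast Real.pi_ne_zero
  conv_lhs => rw [← Complex.re_add_im w, h0]
  push_cast
  field_simp
  ring

/-- Points whose argument is close to an odd multiple of `π / p ^ n` are not in the Cantor set. -/
theorem exp_notMem_Eset {p : ℕ} (hp : 3 ≤ p) (n j : ℕ) {w : ℂ}
    (hw : |w.im - 2 * Real.pi * (j - 1 / 2) / (p : ℝ) ^ n| ≤ 1 / (p : ℝ) ^ n) :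
    exp w ∉ Eset (1 / (p : ℝ)) := by
  intro hmem
  have hp0 : (0 : ℝ) < p := by exact_mod_cast (by lia : 0 < p)
  have hq : (0 : ℝ) < (p : ℝ) ^ n := by positivity
  have hpi := Real.pi_gt_three
  have h1 := pow_mem_Eset (by lia) hmem n
  rw [exp_eq_of_norm_exp_eq_one (norm_of_mem_Eset hmem), ← Complex.exp_nat_mul] at h1
  have e : ((p ^ n : ℕ) : ℂ) * (2 * Real.pi * I * ((w.im / (2 * Real.pi) : ℝ) : ℂ)) =
      2 * Real.pi * I * (((p : ℝ) ^ n * (w.im / (2 * Real.pi)) : ℝ) : ℂ) := by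
    push_cast; ring
  rw [e] at h1
  obtain ⟨k, hk⟩ := near_int_of_mem_Eset hp h1
  have e2 : (p : ℝ) ^ n * (w.im / (2 * Real.pi)) - (j - 1 / 2) =
      (p : ℝ) ^ n * (w.im - 2 * Real.pi * (j - 1 / 2) / (p : ℝ) ^ n) / (2 * Real.pi) := by
    field_simp
  have h2 : |(p : ℝ) ^ n * (w.im / (2 * Real.pi)) - (j - 1 / 2)| < 1 / 6 := by
    rw [e2, abs_div, abs_mul, abs_of_pos hq, abs_of_pos (by positivity : 0 < 2 * Real.pi),
      div_lt_iff₀ (by positivity)]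
    calc _ ≤ (p : ℝ) ^ n * (1 / (p : ℝ) ^ n) := by gcongr
      _ = 1 := by field_simp
      _ < _ := by linarith
  rw [abs_le] at hk
  rw [abs_lt] at h2
  have h3 : ((k - j : ℤ) : ℝ) < 0 := by push_cast; linarith
  have h4 : (-1 : ℝ) < ((k - j : ℤ) : ℝ) := by push_cast; linarith
  have h5 : k - j < 0 := by exact_mod_cast h3
  have h6 : -1 < k - j := by exact_mod_cast h4
  lia

theorem exists_cantorNum_norm_exp_sub_le {p : ℕ} (hp : 3 ≤ p) (n : ℕ) {w w₀ : ℂ}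
    (h₀ : exp w₀ ∈ Eset (1 / (p : ℝ))) (hre : |w.re| ≤ 1 / (p : ℝ) ^ n)
    (him : |w.im - w₀.im| ≤ 2 * Real.pi / (p : ℝ) ^ n) :
    ∃ m ∈ cantorNum p n,
      ‖exp w - exp (2 * Real.pi * I * ((m / (p : ℝ) ^ n : ℝ) : ℂ))‖ ≤ 16 / (p : ℝ) ^ n := by
  have hp1 : (1 : ℝ) < p := by exact_mod_cast (by lia : 1 < p)
  have hq : (1 : ℝ) ≤ (p : ℝ) ^ n := one_le_pow₀ hp1.le
  have hpi := Real.pi_pos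
  obtain ⟨x, hx, hxe⟩ := mem_Eset_iff.1 h₀
  obtain ⟨m, hm, y, hy, rfl⟩ := cantorReal_prefix (by lia) hx n
  have hy1 := cantorReal_subset_Icc (by positivity) ((div_lt_one (by positivity)).2 hp1) hy
  refine ⟨m, hm, ?_⟩
  have a1 : ‖exp w - exp (2 * Real.pi * I * ((w.im / (2 * Real.pi) : ℝ) : ℂ))‖ ≤
      2 / (p : ℝ) ^ n := by
    have e1 : exp w = ((Real.exp w.re : ℝ) : ℂ) * exp (w.im * I) := by
      rw [Complex.ofReal_exp, ← Complex.exp_add, Complex.re_add_im]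
    have e2 : (2 * Real.pi * I * ((w.im / (2 * Real.pi) : ℝ) : ℂ)) = w.im * I := by
      have hpi : (Real.pi : ℂ) ≠ 0 := by exact_mod_cast Real.pi_ne_zero
      push_cast
      field_simp
    have e3 : exp w - exp (w.im * I) = ((Real.exp w.re - 1 : ℝ) : ℂ) * exp (w.im * I) := by
      rw [e1]; push_cast; ring
    rw [e2, e3, norm_mul, Complex.norm_exp_ofReal_mul_I, mul_one, Complex.norm_real]
    exact abs_exp_sub_one_le_of_abs_le hq hre
  have a2 : ‖exp (2 * Real.pi * I * ((w.im / (2 * Real.pi) : ℝ) : ℂ)) - exp w₀‖ ≤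
      2 * Real.pi / (p : ℝ) ^ n := by
    rw [exp_eq_of_norm_exp_eq_one (norm_of_mem_Eset h₀)]
    refine (norm_exp_two_pi_sub_le _ _).trans (le_trans (le_of_eq ?_) him)
    rw [← sub_div, abs_div, abs_of_pos (by positivity : 0 < 2 * Real.pi)]
    field_simp
  have a3 : ‖exp w₀ - exp (2 * Real.pi * I * ((m / (p : ℝ) ^ n : ℝ) : ℂ))‖ ≤
      2 * Real.pi / (p : ℝ) ^ n := by
    rw [hxe]
    refine (norm_exp_two_pi_sub_le _ _).trans ?_
    rw [← sub_div, add_sub_cancel_left, abs_div, abs_of_pos (by positivity : 0 < (p : ℝ) ^ n),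
      abs_of_nonneg hy1.1, ← mul_div_assoc]
    exact div_le_div_of_nonneg_right (mul_le_of_le_one_right (by positivity) hy1.2) (by positivity)
  refine (norm_sub_le_norm_sub_add_norm_sub _
    (exp (2 * Real.pi * I * ((w.im / (2 * Real.pi) : ℝ) : ℂ))) _).trans ?_
  refine (add_le_add a1 ((norm_sub_le_norm_sub_add_norm_sub _ (exp w₀) _).trans
    (add_le_add a2 a3))).trans ?_
  rw [← add_div, ← add_div]
  gcongr
  linarith [Real.pi_lt_d2]

section SpectralBound

variable {A : Type*} [NormedRing A] [NormedAlgebra ℂ A] [CompleteSpace A]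

/-- A bound for the resolvent on a segment crossing the unit circle at a distance `1 / q` from the
spectrum. -/
theorem norm_resolvent_exp_le_of_gap {a : A} {γ K q y : ℝ} (h0 : 0 < γ) (h1 : γ < 1) (hK : 0 < K)
    (hq : 1 ≤ q) (hgap : ∀ w : ℂ, |w.im - y| ≤ 1 / q → exp w ∈ resolventSet ℂ a)
    (hb : ∀ w : ℂ, w.re ≠ 0 → |w.re| ≤ 1 →
      ‖resolvent a (exp w)‖ ≤ Real.exp (K * |w.re| ^ (-γ)))
    {x : ℝ} (hx : |x| ≤ 1 / q) :
    ‖resolvent a (exp (x + y * I))‖ ≤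
      Real.exp ((1 + 2 * (2 ^ γ / Real.cos (γ * (Real.pi / 2)))) * (K * q ^ γ)) := by
  have hq0 : 0 < q := by linarith
  have hre : ∀ v : ℂ, (v / q + y * I : ℂ).re = v.re / q := fun v => by
    simp [Complex.div_ofReal_re]
  have him : ∀ v : ℂ, (v / q + y * I : ℂ).im = v.im / q + y := fun v => by
    simp [Complex.div_ofReal_im]
  have := norm_le_exp_of_growth (f := fun v : ℂ => resolvent a (exp (v / q + y * I))) h0 h1
    (K := K * q ^ γ) (by positivity) (fun v _ hv => ?_) (fun v hv0 hv1 _ => ?_) (x := x * q) ?_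
  · have e : (((x * q : ℝ) : ℂ) / q + y * I) = x + y * I := by
      have : (q : ℂ) ≠ 0 := by exact_mod_cast hq0.ne'
      push_cast
      field_simp
    simpa only [e] using this
  · have hm : exp (v / q + y * I) ∈ resolventSet ℂ a := by
      refine hgap _ ?_
      rw [him, add_sub_cancel_right, abs_div, abs_of_pos hq0]
      gcongr
    exact DifferentiableAt.comp (f := fun v : ℂ => exp (v / q + y * I)) v
      (differentiableAt_resolvent hm) (by fun_prop)
  · refine (hb _ (by rw [hre]; exact div_ne_zero hv0 hq0.ne') ?_).trans (le_of_eq ?_)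
    · rw [hre, abs_div, abs_of_pos hq0]
      exact (div_le_self (abs_nonneg _) hq).trans hv1
    · rw [hre, abs_div, abs_of_pos hq0, Real.div_rpow (abs_nonneg _) hq0.le,
        Real.rpow_neg hq0.le, div_inv_eq_mul]
      ring_nf
  · rw [abs_mul, abs_of_pos hq0]
    exact (le_div_iff₀ hq0).1 hx

end SpectralBound

section InverseBound

variable {A : Type*} [NormedRing A] [NormedAlgebra ℂ A] [CompleteSpace A] [NormOneClass A]

/-- The integral of `f(z) (z - u)⁻¹` over two circles around the spectrum is small when `f` is
small near the spectrum, which bounds the residue `f 0 • u⁻¹`. -/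
theorem mul_norm_inv_le_of_multiplier {p : ℕ} (hp : 3 ≤ p) (u : Aˣ) (hu : ‖(u : A)‖ ≤ 1)
    (hσ : spectrum ℂ (u : A) ⊆ Eset (1 / (p : ℝ))) {γ K : ℝ} (h0 : 0 < γ) (h1 : γ < 1)
    (hK : 0 < K) (hb : ∀ w : ℂ, w.re ≠ 0 → |w.re| ≤ 1 →
      ‖resolvent (u : A) (exp w)‖ ≤ Real.exp (K * |w.re| ^ (-γ)))
    {n : ℕ} {f : ℂ → ℂ} {L η : ℝ}
    (hf : DifferentiableOn ℂ f (ball 0 (1 + 4 / (p : ℝ) ^ n)))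
    (hf1 : ∀ z, ‖z‖ ≤ 1 + 2 / (p : ℝ) ^ n → ‖f z‖ ≤ 1)
    (hf2 : ∀ z, ‖z‖ ≤ 1 → ‖deriv (deriv f) z‖ ≤ L)
    (hfσ : ∀ z, ‖z‖ ≤ 1 + 2 / (p : ℝ) ^ n → ∀ m ∈ cantorNum p n,
      ‖z - exp (2 * Real.pi * I * ((m / (p : ℝ) ^ n : ℝ) : ℂ))‖ ≤ 16 / (p : ℝ) ^ n →
        ‖f z‖ ≤ Real.exp (-η)) :
    ‖f 0‖ * ‖((u⁻¹ : Aˣ) : A)‖ ≤ 1 + L + 4 * Real.exp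
      ((1 + 2 * (2 ^ γ / Real.cos (γ * (Real.pi / 2)))) * (K * ((p : ℝ) ^ n) ^ γ) - η) := by
  set q : ℝ := (p : ℝ) ^ n with hqdef
  set M : ℝ := (1 + 2 * (2 ^ γ / Real.cos (γ * (Real.pi / 2)))) * (K * q ^ γ) with hM
  have hpi := Real.pi_gt_three
  have hpi2 := Real.pi_lt_d2
  have hp1 : (1 : ℝ) < p := by exact_mod_cast (by lia : 1 < p)
  have hq : (1 : ℝ) ≤ q := one_le_pow₀ hp1.le
  have hq0 : 0 < q := by linarith
  have hcos : 0 < Real.cos (γ * (Real.pi / 2)) :=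
    Real.cos_pos_of_mem_Ioo ⟨by nlinarith, by nlinarith⟩
  have hKM : K * q ^ γ ≤ M := by
    have h : 0 < 2 ^ γ / Real.cos (γ * (Real.pi / 2)) := by positivity
    exact le_mul_of_one_le_left (by positivity) (by linarith)
  have hnorm : ∀ w : ℂ, |w.re| ≤ 1 / q → ‖exp w‖ ≤ 1 + 2 / q := fun w hw => by
    rw [Complex.norm_exp]
    linarith [(abs_le.1 (abs_exp_sub_one_le_of_abs_le hq hw)).2]
  have hlt : (1 : ℝ) + 2 / q < 1 + 4 / q := by gcongr; norm_num
  have hres : ∀ w : ℂ, exp w ∉ Eset (1 / (p : ℝ)) → exp w ∈ resolventSet ℂ (u : A) := fun w hw => by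
    by_contra h
    exact hw (hσ h)
  have hres0 : ∀ w : ℂ, w.re ≠ 0 → exp w ∈ resolventSet ℂ (u : A) := fun w hw => hres w fun h => by
    have := norm_of_mem_Eset h
    rw [Complex.norm_exp, Real.exp_eq_one_iff] at this
    exact hw this
  set G : ℂ → A := fun w => f (exp w) • resolvent (u : A) (exp w) with hG
  have hGd : ∀ w : ℂ, |w.re| ≤ 1 / q → exp w ∈ resolventSet ℂ (u : A) →
      DifferentiableAt ℂ G w := fun w hw hm => by
    have hfd : DifferentiableAt ℂ f (exp w) := hf.differentiableAt
      (isOpen_ball.mem_nhds (by rw [mem_ball_zero_iff]; exact (hnorm w hw).trans_lt hlt))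
    exact (DifferentiableAt.comp w hfd (by fun_prop)).smul
      (DifferentiableAt.comp (g := resolvent (u : A)) w (differentiableAt_resolvent hm)
        (by fun_prop))
  have hGc : ∀ a : ℝ, a ≠ 0 → |a| ≤ 1 / q → Continuous fun t : ℝ => G (a + t * I) :=
    fun a ha0 ha => by
      refine continuous_iff_continuousAt.2 fun t => ?_
      have hd : DifferentiableAt ℂ G (a + t * I) :=
        hGd _ (by simpa using ha) (hres0 _ (by simpa using ha0))
      exact ContinuousAt.comp (f := fun t : ℝ => (a + t * I : ℂ)) hd.continuousAt (by fun_prop)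
  have hq1 : 1 / q ≤ 1 := (div_le_one hq0).2 hq
  have hqa : |1 / q| ≤ 1 / q := (abs_of_pos (by positivity)).le
  have hqa' : |-(1 / q)| ≤ 1 / q := by rwa [abs_neg]
  have hq00 : 1 / q ≠ 0 := by positivity
  have hvert : ∀ w : ℂ, |w.re| = 1 / q → ‖resolvent (u : A) (exp w)‖ ≤ Real.exp M := fun w hw => by
    refine (hb w (fun h => hq00 (by rw [← hw, h, abs_zero])) (hw.le.trans hq1)).trans ?_
    rw [hw, one_div, Real.inv_rpow hq0.le, Real.rpow_neg hq0.le, inv_inv]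
    exact Real.exp_le_exp.2 hKM
  set y : ℕ → ℝ := fun j => 2 * Real.pi * (j - 1 / 2) / q with hy
  have hhor : ∀ j : ℕ, ∀ x : ℝ, |x| ≤ 1 / q →
      ‖resolvent (u : A) (exp (x + y j * I))‖ ≤ Real.exp M :=
    fun j x hx => norm_resolvent_exp_le_of_gap h0 h1 hK hq
      (fun w hw => hres w (exp_notMem_Eset hp n j hw)) hb hx
  have hstep : ∀ j : ℕ, y (j + 1) - y j = 2 * Real.pi / q := fun j => by
    simp only [hy]; push_cast; ring
  have hcell : ∀ j < p ^ n, ‖rectIntegral G (-(1 / q)) (1 / q) (y j) (y (j + 1))‖ ≤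
      Real.exp (M - η) * (20 / q) := fun j _ => by
    have hyle : y j ≤ y (j + 1) := by
      have := hstep j
      have : 0 < 2 * Real.pi / q := by positivity
      linarith
    by_cases hcase : ∃ w : ℂ, w.im ∈ Icc (y j) (y (j + 1)) ∧ exp w ∈ Eset (1 / (p : ℝ))
    · obtain ⟨w₀, hw₀, hmem⟩ := hcase
      have hsmall : ∀ x t : ℝ, |x| ≤ 1 / q → t ∈ Icc (y j) (y (j + 1)) →
          ‖resolvent (u : A) (exp (x + t * I))‖ ≤ Real.exp M → ‖G (x + t * I)‖ ≤ Real.exp (M - η) :=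
        fun x t hx ht hR => by
          have hre : |(x + t * I : ℂ).re| ≤ 1 / q := by simpa using hx
          obtain ⟨m, hm, hmd⟩ := exists_cantorNum_norm_exp_sub_le (w := x + t * I) hp n hmem hre (by
            have him : (x + t * I : ℂ).im = t := by simp
            rw [him, ← hstep j, abs_le]
            constructor <;> linarith [ht.1, ht.2, hw₀.1, hw₀.2])
          have := hfσ _ (hnorm _ hre) m hm hmd
          rw [hG, norm_smul, sub_eq_neg_add, Real.exp_add]
          gcongr
      have hle : -(1 / q) ≤ 1 / q := by linarith [show 0 < 1 / q by positivity]
      refine (norm_rectIntegral_le (ε := Real.exp (M - η)) hle hyle (fun x hx => ?_)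
        fun t ht => ?_).trans ?_
      · have hx' := abs_le.2 hx
        exact ⟨hsmall _ _ hx' (left_mem_Icc.2 hyle) (hhor j x hx'),
          hsmall _ _ hx' (right_mem_Icc.2 hyle) (hhor (j + 1) x hx')⟩
      · have e1 := hvert ((-(1 / q) : ℝ) + t * I) (by simp [abs_of_pos hq0])
        have e2 := hvert ((1 / q : ℝ) + t * I) (by simp [abs_of_pos hq0])
        exact ⟨hsmall _ _ hqa' ht e1, hsmall _ _ hqa ht e2⟩
      · rw [hstep]
        gcongr
        rw [show 2 * (1 / q - -(1 / q)) + 2 * (2 * Real.pi / q) = (4 + 4 * Real.pi) / q by ring]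
        gcongr
        linarith
    · push Not at hcase
      rw [rectIntegral_eq_zero (by linarith [show 0 < 1 / q by positivity]) hyle
        fun w hw1 hw2 => hGd w (abs_le.2 hw1) (hres w (hcase w hw2)), norm_zero]
      positivity
  have hdiff := norm_integral_sub_integral_le_of_periodic (g := G)
    (fun w => by simp only [hG, Complex.exp_add, Complex.exp_two_pi_mul_I, mul_one])
    (hGc (-(1 / q)) (neg_ne_zero.2 hq00) hqa') (hGc (1 / q) hq00 hqa) (y := y) (q := p ^ n)
    (by simp only [hy]; push_cast; rw [← hqdef]; field_simp; ring) hcell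
  have hcast : ((p ^ n : ℕ) : ℝ) = q := by push_cast; rfl
  rw [hcast] at hdiff
  have houter : ‖∫ t in (0 : ℝ)..2 * Real.pi, G ((1 / q : ℝ) + t * I)‖ ≤ 2 * Real.pi * (1 + L) := by
    have hlt2 : Real.exp (1 / q) < 1 + 4 / q := by
      have := (abs_le.1 (abs_exp_sub_one_le_of_abs_le hq hqa)).2
      linarith
    refine norm_integral_smul_resolvent_le hu (by positivity) hlt2 hf fun m => ?_
    exact sum_norm_iteratedDeriv_le (by linarith [show 0 < 4 / q by positivity]) hf
      (fun z hz => hf1 z (by linarith [show 0 < 2 / q by positivity])) hf2 m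
  have hinner : ∫ t in (0 : ℝ)..2 * Real.pi, G ((-(1 / q) : ℝ) + t * I) =
      (2 * Real.pi : ℂ) • f 0 • (-((u⁻¹ : Aˣ) : A)) := by
    have hR0 : resolvent (u : A) (0 : ℂ) = -((u⁻¹ : Aˣ) : A) := by
      rw [resolvent, map_zero, zero_sub]
      exact ringInverse_eq_of_mul_eq_one (by simp) (by simp)
    have := integral_exp_inv_pow_smul (r := -(1 / q)) (ρ := 1)
      (g := fun z => f z • resolvent (u : A) z) (fun z hz => ?_)
      (Real.exp_lt_one_iff.2 (by rw [neg_lt_zero]; positivity)) 0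
    · simpa [hR0, hG] using this
    · rw [mem_ball_zero_iff] at hz
      refine DifferentiableAt.differentiableWithinAt (DifferentiableAt.fun_smul ?_ ?_)
      · exact hf.differentiableAt (isOpen_ball.mem_nhds
          (by rw [mem_ball_zero_iff]; linarith [show 0 < 4 / q by positivity]))
      · refine differentiableAt_resolvent ?_
        by_contra h
        linarith [norm_of_mem_Eset (hσ h)]
  have hfin : 2 * Real.pi * (‖f 0‖ * ‖((u⁻¹ : Aˣ) : A)‖) ≤
      2 * Real.pi * (1 + L) + 20 * Real.exp (M - η) := by
    have e1 : ‖∫ t in (0 : ℝ)..2 * Real.pi, G ((-(1 / q) : ℝ) + t * I)‖ =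
        2 * Real.pi * (‖f 0‖ * ‖((u⁻¹ : Aˣ) : A)‖) := by
      rw [hinner, norm_smul, norm_smul, norm_neg, norm_mul, Complex.norm_real,
        Real.norm_of_nonneg (by linarith)]
      simp
    have e2 : q * (Real.exp (M - η) * (20 / q)) = 20 * Real.exp (M - η) := by
      field_simp
    rw [← e1]
    rw [e2] at hdiff
    have := norm_le_norm_add_norm_sub' (∫ t in (0 : ℝ)..2 * Real.pi, G ((-(1 / q) : ℝ) + t * I))
      (∫ t in (0 : ℝ)..2 * Real.pi, G ((1 / q : ℝ) + t * I))
    rw [norm_sub_rev] at this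
    linarith
  have hE := Real.exp_pos (M - η)
  refine le_of_mul_le_mul_left (hfin.trans ?_) (by positivity : 0 < 2 * Real.pi)
  nlinarith

/-- The main estimate: a contraction with spectrum in the Cantor set of ratio `1 / p` whose inverse
has slow growth satisfies a bound on its inverse which does not depend on the growth constants. -/
theorem exists_norm_inv_le {p : ℕ} (hp : 3 ≤ p) {α : ℝ} (hα0 : 0 < α) (hα1 : α < 1) {β : ℝ}
    (hαβ : α / (1 - α) < β) (hβ : 2 * (p : ℝ) ^ (β - 1) < 1) :
    ∃ Λ : ℝ, ∀ {A : Type*} [NormedRing A] [NormedAlgebra ℂ A] [CompleteSpace A] [NormOneClass A]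
      (u : Aˣ), ‖(u : A)‖ ≤ 1 → spectrum ℂ (u : A) ⊆ Eset (1 / (p : ℝ)) →
      (∃ B : ℝ, ∀ k : ℕ, 1 ≤ k → ‖((u⁻¹ : Aˣ) : A) ^ k‖ ≤ Real.exp (B * (k : ℝ) ^ α)) →
      ‖((u⁻¹ : Aˣ) : A)‖ ≤ Λ := by
  have hp1 : (1 : ℝ) < p := by exact_mod_cast (by lia : 1 < p)
  have hγ0 : 0 < α / (1 - α) := div_pos hα0 (by linarith)
  have hβ1 : β < 1 := by
    by_contra h
    have : (1 : ℝ) ≤ (p : ℝ) ^ (β - 1) := Real.one_le_rpow hp1.le (by linarith)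
    linarith
  obtain ⟨L, c, hc, hL⟩ := exists_multiplier hp (hγ0.trans hαβ) hβ
  refine ⟨(1 + L) / c, fun {A} _ _ _ _ u hu hσ ⟨B, hB⟩ => ?_⟩
  obtain ⟨K, hK0, hK⟩ := norm_resolvent_exp_le u hu hα0 hα1 hB
  set γ := α / (1 - α) with hγ
  set D : ℝ := (1 + 2 * (2 ^ γ / Real.cos (γ * (Real.pi / 2)))) * (K + 1) with hD
  have key : ∀ n : ℕ, c * ‖(↑(u⁻¹) : A)‖ ≤ 1 + L +
      4 * Real.exp (D * ((p : ℝ) ^ n) ^ γ - ((p : ℝ) ^ n) ^ β / 200) := fun n => by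
    obtain ⟨f, hf, hf1, hf0, hf2, hfσ⟩ := hL n
    have := mul_norm_inv_le_of_multiplier hp u hu hσ hγ0 (hαβ.trans hβ1) (K := K + 1)
      (by linarith) (fun w hw hw1 => (hK w hw hw1).trans (by gcongr; linarith)) hf hf1 hf2 hfσ
    rw [← mul_assoc] at this
    exact (mul_le_mul_of_nonneg_right hf0 (norm_nonneg _)).trans this
  have hq : Filter.Tendsto (fun n : ℕ => (p : ℝ) ^ n) Filter.atTop Filter.atTop :=
    tendsto_pow_atTop_atTop_of_one_lt hp1
  have hlim0 : Filter.Tendsto (fun x : ℝ => D * x ^ γ - x ^ β / 200) Filter.atTop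
      Filter.atBot := by
    have h1 : Filter.Tendsto (fun x : ℝ => x ^ γ) Filter.atTop Filter.atTop :=
      tendsto_rpow_atTop hγ0
    have h2 : Filter.Tendsto (fun x : ℝ => D - x ^ (β - γ) / 200) Filter.atTop Filter.atBot := by
      refine Filter.tendsto_atBot_add_const_left _ D ?_
      exact Filter.tendsto_neg_atTop_atBot.comp
        ((tendsto_rpow_atTop (sub_pos.2 hαβ)).atTop_div_const (by norm_num))
    refine (h1.atTop_mul_atBot₀ h2).congr' ?_
    filter_upwards [Filter.eventually_gt_atTop 0] with x hx
    rw [mul_sub, mul_div_assoc', ← Real.rpow_add hx]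
    ring_nf
  have hlim : Filter.Tendsto (fun n : ℕ => 1 + L +
      4 * Real.exp (D * ((p : ℝ) ^ n) ^ γ - ((p : ℝ) ^ n) ^ β / 200)) Filter.atTop
      (nhds (1 + L + 4 * 0)) :=
    ((Real.tendsto_exp_atBot.comp (hlim0.comp hq)).const_mul 4).const_add _
  rw [mul_zero, add_zero] at hlim
  rw [le_div_iff₀ hc, mul_comm]
  exact ge_of_tendsto' hlim key

end InverseBound

section PowerBounds

variable {A : Type*} [NormedRing A] [NormedAlgebra ℂ A] [CompleteSpace A] [NormOneClass A]

theorem exists_forall_norm_inv_pow_le {p : ℕ} (hp : 3 ≤ p) {α β C : ℝ} (hα0 : 0 < α) (hα1 : α < 1)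
    (hαβ : α / (1 - α) < β) (hβ : 2 * (p : ℝ) ^ (β - 1) < 1) (u : Aˣ) (hu : ‖(u : A)‖ ≤ 1)
    (hσ : spectrum ℂ (u : A) ⊆ Eset (1 / (p : ℝ)))
    (hC : ∀ n : ℕ, 1 ≤ n → ‖((u⁻¹ : Aˣ) : A) ^ n‖ ≤ Real.exp (C * (n : ℝ) ^ α)) :
    ∃ Λ : ℝ, ∀ n : ℕ, ‖((u⁻¹ : Aˣ) : A) ^ n‖ ≤ Λ := by
  obtain ⟨Λ, hΛ⟩ := exists_norm_inv_le hp hα0 hα1 hαβ hβ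
  have hpow : ∀ N : ℕ, ‖((u⁻¹ : Aˣ) : A) ^ p ^ N‖ ≤ Λ := fun N => by
    have hpN : 0 < p ^ N := by positivity
    have := hΛ (u ^ p ^ N) ?_ ?_ ⟨C * ((p ^ N : ℕ) : ℝ) ^ α, fun k hk => ?_⟩
    · rwa [← inv_pow, Units.val_pow_eq_pow_val] at this
    · rw [Units.val_pow_eq_pow_val]
      exact (norm_pow_le _ _).trans (pow_le_one₀ (norm_nonneg _) hu)
    · rw [Units.val_pow_eq_pow_val, spectrum.map_pow_of_pos _ hpN]
      rintro _ ⟨z, hz, rfl⟩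
      exact pow_mem_Eset (by lia) (hσ hz) N
    · rw [← inv_pow, Units.val_pow_eq_pow_val, ← pow_mul]
      refine (hC _ (Nat.mul_pos hpN hk)).trans (le_of_eq ?_)
      rw [Nat.cast_mul, Real.mul_rpow (Nat.cast_nonneg _) (Nat.cast_nonneg _), mul_assoc]
  refine ⟨Λ, fun n => ?_⟩
  obtain ⟨m, hm⟩ := Nat.exists_eq_add_of_le' (Nat.lt_pow_self (by lia : 1 < p) (n := n)).le
  have e : ((u⁻¹ : Aˣ) : A) ^ n = (u : A) ^ m * ((u⁻¹ : Aˣ) : A) ^ p ^ n := by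
    have : u⁻¹ ^ n = u ^ m * u⁻¹ ^ p ^ n := by
      rw [hm, pow_add, ← mul_assoc, inv_pow u m, mul_inv_cancel, one_mul]
    exact_mod_cast congrArg Units.val this
  rw [e]
  calc _ ≤ ‖(u : A) ^ m‖ * ‖((u⁻¹ : Aˣ) : A) ^ p ^ n‖ := norm_mul_le _ _
    _ ≤ 1 * Λ := by
      gcongr
      · exact (norm_pow_le _ _).trans (pow_le_one₀ (norm_nonneg _) hu)
      · exact hpow n
    _ = Λ := one_mul Λ

/-- A doubly power-bounded element with Dirichlet spectrum is rigid: some powers tend to `1`. -/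
theorem eventually_norm_pow_sub_one_lt (u : Aˣ) {L : ℝ} (h : ∀ k : ℕ, ‖(u : A) ^ k‖ ≤ L)
    (h' : ∀ k : ℕ, ‖((u⁻¹ : Aˣ) : A) ^ k‖ ≤ L) {n : ℕ → ℕ} (hn : Filter.Tendsto n atTop atTop)
    (hσ : ∀ ε > 0, ∀ᶠ k in atTop, ∀ z ∈ spectrum ℂ (u : A), ‖z ^ n k - 1‖ < ε)
    {ε : ℝ} (hε : 0 < ε) : ∀ᶠ k in atTop, ‖(u : A) ^ n k - 1‖ < ε := by
  have hL : 1 ≤ L := by simpa using h 0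
  set s : ℝ := 1 + 16 * L / ε with hs
  have hs1 : 0 < 16 * L / ε := by positivity
  filter_upwards [hσ (1 / (s + 1 / 2)) (by positivity), hn.eventually_ge_atTop 1] with k hk hk1
  have := norm_unit_sub_one_le (u ^ n k) (s := s) (L := L) (by linarith) (fun j => ?_)
    (fun j => ?_) ?_
  · rw [Units.val_pow_eq_pow_val] at this
    refine this.trans_lt ?_
    rw [hs, add_sub_cancel_left, div_lt_iff₀ hs1]
    field_simp
    norm_num
  · rw [Units.val_pow_eq_pow_val, ← pow_mul]
    exact h _
  · rw [← inv_pow, Units.val_pow_eq_pow_val, ← pow_mul]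
    exact h' _
  · rw [Units.val_pow_eq_pow_val, spectrum.map_pow_of_pos _ hk1]
    rintro _ ⟨z, hz, rfl⟩
    exact hk z hz

end PowerBounds

theorem exists_exponent_between {p : ℕ} (hp : 3 ≤ p) {α : ℝ}
    (hα : α < (Real.log p - Real.log 2) / (2 * Real.log p - Real.log 2)) :
    α < 1 ∧ ∃ β : ℝ, α / (1 - α) < β ∧ 2 * (p : ℝ) ^ (β - 1) < 1 := by
  have hp2 : (2 : ℝ) < p := by exact_mod_cast (by lia : 2 < p)
  have h2 : 0 < Real.log 2 := Real.log_pos (by norm_num)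
  have hlt : Real.log 2 < Real.log p := Real.log_lt_log (by norm_num) hp2
  have hp0 : 0 < Real.log p := h2.trans hlt
  rw [lt_div_iff₀ (by linarith)] at hα
  have hα1 : α < 1 := by nlinarith
  have hγ : α / (1 - α) < (Real.log p - Real.log 2) / Real.log p := by
    rw [div_lt_div_iff₀ (by linarith) hp0]
    linarith
  obtain ⟨β, hβ1, hβ2⟩ := exists_between hγ
  refine ⟨hα1, β, hβ1, ?_⟩
  rw [lt_div_iff₀ hp0] at hβ2
  have : (p : ℝ) ^ (β - 1) < 2⁻¹ := by
    rw [Real.rpow_def_of_pos (by linarith), ← Real.exp_log (by norm_num : (0 : ℝ) < 2⁻¹),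
      Real.log_inv]
    exact Real.exp_lt_exp.2 (by linarith)
  linarith

/-- Under the hypotheses of Statement 15, if moreover `Sp T` is a
Dirichlet set, then `T` is an (invertible) isometry. -/
theorem stmt_16 (p : ℕ) (hp : 3 ≤ p)
    {X : Type} [NormedAddCommGroup X] [NormedSpace ℂ X] [CompleteSpace X]
    (T Tinv : X →L[ℂ] X) (hT : ‖T‖ ≤ 1) (h1 : T * Tinv = 1) (h2 : Tinv * T = 1)
    (hsp : spectrum ℂ T ⊆ Eset (1 / (p : ℝ)))
    (α : ℝ) (hα : α < (Real.log p - Real.log 2) / (2 * Real.log p - Real.log 2))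
    (hbd : ∃ C : ℝ, ∀ n : ℕ, 1 ≤ n →
      max (Real.log ‖Tinv ^ n‖) 0 ≤ C * (n : ℝ) ^ α)
    (hdir : IsDirichletSet (spectrum ℂ T)) :
    ∀ x : X, ‖T x‖ = ‖x‖ := by
  rcases subsingleton_or_nontrivial X with hX | hX
  · intro x
    rw [Subsingleton.elim (T x) x]
  set u : (X →L[ℂ] X)ˣ := ⟨T, Tinv, h1, h2⟩
  set τ : ℝ := (Real.log p - Real.log 2) / (2 * Real.log p - Real.log 2) with hτ
  have hτ0 : 0 < τ := by
    have h2 : 0 < Real.log 2 := Real.log_pos (by norm_num)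
    have : Real.log 2 < Real.log p :=
      Real.log_lt_log (by norm_num) (by exact_mod_cast (by lia : 2 < p))
    exact div_pos (by linarith) (by linarith)
  obtain ⟨hα1, β, hαβ, hβ⟩ :=
    exists_exponent_between hp (α := max α (τ / 2)) (max_lt hα (by linarith))
  obtain ⟨C, hC⟩ := hbd
  have hgrowth : ∀ n : ℕ, 1 ≤ n →
      ‖((u⁻¹ : (X →L[ℂ] X)ˣ) : X →L[ℂ] X) ^ n‖ ≤
        Real.exp (max C 0 * (n : ℝ) ^ max α (τ / 2)) := fun n hn => by
    change ‖Tinv ^ n‖ ≤ _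
    rcases (norm_nonneg (Tinv ^ n)).eq_or_lt with h | h
    · rw [← h]; positivity
    · rw [← Real.log_le_iff_le_exp h]
      calc _ ≤ C * (n : ℝ) ^ α := (le_max_left _ _).trans (hC n hn)
        _ ≤ max C 0 * (n : ℝ) ^ max α (τ / 2) := by
          gcongr
          · exact le_max_left _ _
          · exact_mod_cast hn
          · exact le_max_left _ _
  obtain ⟨Λ, hΛ⟩ := exists_forall_norm_inv_pow_le hp (lt_max_of_lt_right (by linarith)) hα1 hαβ hβ
    u hT hsp hgrowth
  obtain ⟨n, hn, hnσ⟩ := hdir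
  intro x
  have hle : ∀ y : X, ‖T y‖ ≤ ‖y‖ := fun y => by
    simpa using T.le_of_opNorm_le hT y
  refine le_antisymm (hle x) (le_of_forall_pos_lt_add fun ε hε => ?_)
  have hpow : ∀ k : ℕ, ‖T ^ k‖ ≤ 1 := fun k =>
    (norm_pow_le _ _).trans (pow_le_one₀ (norm_nonneg _) hT)
  obtain ⟨k, hk, hk1⟩ := ((eventually_norm_pow_sub_one_lt u (L := max 1 Λ)
    (fun k => (hpow k).trans (le_max_left _ _)) (fun k => (hΛ k).trans (le_max_right _ _)) hn hnσ
    (div_pos hε (by positivity : 0 < ‖x‖ + 1))).and (hn.eventually_ge_atTop 1)).exists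
  obtain ⟨m, hm⟩ := Nat.exists_eq_add_of_le' hk1
  have a1 : ‖(T ^ n k) x‖ ≤ ‖T x‖ := by
    rw [hm, pow_succ, mul_apply_eq_comp]
    simpa using (T ^ m).le_of_opNorm_le (hpow m) (T x)
  have a2 : ‖(T ^ n k - 1) x‖ < ε := by
    have hk' : ‖T ^ n k - 1‖ < ε / (‖x‖ + 1) := hk
    rw [lt_div_iff₀ (by positivity)] at hk'
    refine lt_of_le_of_lt ((T ^ n k - 1).le_opNorm x) (lt_of_le_of_lt ?_ hk')
    gcongr
    linarith
  have a3 : x = (T ^ n k) x - (T ^ n k - 1) x := by simp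
  calc ‖x‖ = ‖(T ^ n k) x - (T ^ n k - 1) x‖ := by rw [← a3]
    _ ≤ ‖(T ^ n k) x‖ + ‖(T ^ n k - 1) x‖ := norm_sub_le _ _
    _ < ‖T x‖ + ε := add_lt_add_of_le_of_lt a1 a2
end
end

section
/- Let E ⊆ Γ be a set of multiplicity. Then for every sequence (ω_n)_{n≥1} of real numbers with ω_n → +∞, there exists an invertible contraction T on a Banach space with Sp T ⊆ E such that ‖T^{−n}‖ → +∞ as n → ∞ but ‖T^{−n}‖ ≤ ω_n for all sufficiently large n (i.e., ‖T^{−n}‖ tends to infinity arbitrarily slowly). -/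
noncomputable section

open Complex MeasureTheory Metric Set Filter

/-- Below any sequence tending to infinity there is, eventually, a monotone submultiplicative
weight which tends to infinity and grows at most linearly. -/
theorem exists_submultiplicative_weight_le {Ω : ℕ → ℝ} (hΩ : Tendsto Ω atTop atTop) :
    ∃ W : ℕ → ℝ, (∀ n, 1 ≤ W n) ∧ Monotone W ∧ (∀ m n, W (m + n) ≤ W m * W n) ∧
      Tendsto W atTop atTop ∧ (∀ n : ℕ, W n ≤ n + 1) ∧ ∀ᶠ n in atTop, W n ≤ Ω n := by
  obtain ⟨N, hN, hNΩ⟩ : ∃ N : ℕ → ℕ, StrictMono N ∧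
      ∀ k, 1 ≤ N k ∧ ∀ n ≥ N k, (k : ℝ) + 3 ≤ Ω n := by
    refine Filter.extraction_forall_of_eventually' (P := fun k j : ℕ =>
      1 ≤ j ∧ ∀ n ≥ j, (k : ℝ) + 3 ≤ Ω n) fun k => ?_
    obtain ⟨M, hM⟩ := eventually_atTop.1 (hΩ.eventually_ge_atTop ((k : ℝ) + 3))
    exact ⟨M + 1, fun j hj => ⟨by omega, fun n hn => hM n (by omega)⟩⟩
  have hpos : ∀ k, (1 : ℝ) ≤ N k := fun k => by exact_mod_cast (hNΩ k).1
  set g : ℕ → ℝ := fun n => ⨅ k : ℕ, ((k : ℝ) + n / N k) with hg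
  have hbdd : ∀ n : ℕ, BddBelow (range fun k : ℕ => ((k : ℝ) + n / N k)) := fun n =>
    ⟨0, by rintro _ ⟨k, rfl⟩; positivity⟩
  have hle : ∀ n k : ℕ, g n ≤ k + n / N k := fun n k => ciInf_le (hbdd n) k
  have hg0 : ∀ n, 0 ≤ g n := fun n => le_ciInf fun k => by positivity
  have hadd : ∀ m n, g (m + n) ≤ g m + g n := by
    intro m n
    refine le_ciInf_add_ciInf fun i j => ?_
    wlog hij : i ≤ j generalizing m n i j
    · have := this n m j i (by omega)
      rw [add_comm n m] at this
      linarith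
    have h1 := hle (m + n) j
    have h2 : (m : ℝ) / N j ≤ m / N i := by
      have : (N i : ℝ) ≤ N j := by exact_mod_cast hN.monotone hij
      have := hpos i
      gcongr
    push_cast [add_div] at h1
    have : (0 : ℝ) ≤ i := by positivity
    linarith
  refine ⟨fun n => 1 + g n, fun n => by linarith [hg0 n], fun m n hmn => ?_, fun m n => ?_,
    tendsto_atTop.2 fun b => ?_, fun n => ?_, ?_⟩
  · have : g m ≤ g n := ciInf_mono (hbdd m) fun k => by gcongr
    simpa using this
  · nlinarith [hadd m n, hg0 m, hg0 n, mul_nonneg (hg0 m) (hg0 n)]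
  · obtain ⟨K, hK⟩ := exists_nat_ge b
    filter_upwards [eventually_ge_atTop (K * N K)] with n hn
    have : (K : ℝ) ≤ g n := by
      refine le_ciInf fun k => ?_
      rcases le_total K k with h | h
      · have : (K : ℝ) ≤ k := by exact_mod_cast h
        have : (0 : ℝ) ≤ n / N k := by positivity
        linarith
      · have h1 : (K : ℝ) ≤ n / N k := by
          rw [le_div_iff₀ (by linarith [hpos k])]
          exact_mod_cast (Nat.mul_le_mul_left K (hN.monotone h)).trans hn
        have : (0 : ℝ) ≤ k := by positivity
        linarith
    linarith
  · have h1 := hle n 0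
    have h2 : (n : ℝ) / N 0 ≤ n := div_le_self (by positivity) (hpos 0)
    push_cast at h1
    linarith
  · filter_upwards [eventually_ge_atTop (N 0)] with n hn
    have hex : ∃ k, n < N k := ⟨n + 1, hN.le_apply⟩
    obtain ⟨k, hk⟩ : ∃ k, Nat.find hex = k + 1 := by
      refine Nat.exists_eq_succ_of_ne_zero fun h => ?_
      have := Nat.find_spec hex
      rw [h] at this
      omega
    have h1 : N k ≤ n := not_lt.1 (Nat.find_min hex (by omega))
    have h2 : n < N (k + 1) := hk ▸ Nat.find_spec hex
    have h3 := (hNΩ k).2 n h1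
    have h4 := hle n (k + 1)
    have h5 : (n : ℝ) / N (k + 1) ≤ 1 := by
      rw [div_le_one (by linarith [hpos (k + 1)])]
      exact_mod_cast h2.le
    push_cast at h4
    linarith

/-- Differentiating a test function multiplies its `n`-th Fourier coefficient by `in`. -/
theorem testCoeff_deriv {φ : ℝ → ℂ} (hφ : PeriodicSmooth φ) (n : ℤ) :
    testCoeff (deriv φ) n = Complex.I * n * testCoeff φ n := by
  have hd : ∀ θ, HasDerivAt φ (deriv φ θ) θ := fun θ =>
    (hφ.1.differentiable (by simp)).differentiableAt.hasDerivAt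
  have he : ∀ θ : ℝ, HasDerivAt (fun θ : ℝ => Complex.exp (-(n : ℂ) * (θ : ℂ) * Complex.I))
      (Complex.exp (-(n : ℂ) * (θ : ℂ) * Complex.I) * (-(n : ℂ) * Complex.I)) θ := fun θ => by
    have h := ((Complex.ofRealCLM.hasDerivAt (x := θ)).const_mul (-(n : ℂ))).mul_const Complex.I
    simpa using h.cexp
  have hc : Continuous (deriv φ) := hφ.1.continuous_deriv (by simp)
  have h := intervalIntegral.integral_deriv_mul_eq_sub (a := 0) (b := 2 * Real.pi)
    (fun θ _ => hd θ) (fun θ _ => he θ) (hc.intervalIntegrable _ _)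
    (Continuous.intervalIntegrable (by fun_prop) _ _)
  have hper : φ (2 * Real.pi) = φ 0 := by simpa using hφ.2 0
  have hexp : Complex.exp (-(n : ℂ) * ((2 * Real.pi : ℝ) : ℂ) * Complex.I) = 1 := by
    rw [Complex.exp_eq_one_iff]
    exact ⟨-n, by push_cast; ring⟩
  rw [hper, hexp, intervalIntegral.integral_add] at h
  · have h2 : ∫ θ in (0:ℝ)..(2 * Real.pi), φ θ * (Complex.exp (-(n : ℂ) * (θ : ℂ) * Complex.I)
        * (-(n : ℂ) * Complex.I)) = (-(n : ℂ) * Complex.I) * ∫ θ in (0:ℝ)..(2 * Real.pi),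
          φ θ * Complex.exp (-(n : ℂ) * (θ : ℂ) * Complex.I) := by
      rw [← intervalIntegral.integral_const_mul]
      exact intervalIntegral.integral_congr fun θ _ => by ring
    rw [h2] at h
    have h3 : ∫ θ in (0:ℝ)..(2 * Real.pi), deriv φ θ *
        Complex.exp (-(n : ℂ) * (θ : ℂ) * Complex.I) = (n : ℂ) * Complex.I *
          ∫ θ in (0:ℝ)..(2 * Real.pi), φ θ * Complex.exp (-(n : ℂ) * (θ : ℂ) * Complex.I) := by
      simp only [Complex.ofReal_zero, mul_zero, zero_mul, Complex.exp_zero, sub_self] at h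
      linear_combination h
    rw [testCoeff, testCoeff, h3]
    ring
  · exact Continuous.intervalIntegrable (by fun_prop) _ _
  · have := hφ.1.continuous
    exact Continuous.intervalIntegrable (by fun_prop) _ _

theorem PeriodicSmooth.deriv {φ : ℝ → ℂ} (hφ : PeriodicSmooth φ) :
    PeriodicSmooth (deriv φ) := by
  refine ⟨?_, fun θ => ?_⟩
  · have := hφ.1.iterate_deriv 1
    simpa using this
  · rw [← deriv_comp_add_const, funext hφ.2]

theorem norm_testCoeff_le (φ : ℝ → ℂ) :
    ∃ C : ℝ, 0 ≤ C ∧ ∀ n, ‖testCoeff φ n‖ ≤ C := by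
  refine ⟨1 / (2 * Real.pi) * |∫ θ in (0:ℝ)..(2 * Real.pi), ‖φ θ‖|, by positivity, fun n => ?_⟩
  rw [testCoeff, norm_mul]
  have h1 : ‖(1 / (2 * Real.pi) : ℂ)‖ = 1 / (2 * Real.pi) := by
    simp [abs_of_pos Real.pi_pos]
  rw [h1]
  gcongr
  refine (intervalIntegral.norm_integral_le_abs_integral_norm).trans (le_of_eq ?_)
  congr 2
  ext θ
  rw [norm_mul, show -(n : ℂ) * (θ : ℂ) * Complex.I = ((-n * θ : ℝ) : ℂ) * Complex.I by
    push_cast; ring, Complex.norm_exp_ofReal_mul_I, mul_one]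

/-- The Fourier coefficients of a test function decay fast enough to be summable against
linearly growing weights. -/
theorem summable_testCoeff {φ : ℝ → ℂ} (hφ : PeriodicSmooth φ) :
    Summable fun n : ℤ => ‖testCoeff φ n‖ * (n.natAbs + 1) := by
  obtain ⟨C, hC0, hC⟩ := norm_testCoeff_le (deriv (deriv (deriv φ)))
  have hs : Summable fun n : ℤ => 2 * C * (1 / |(n : ℝ)| ^ (2 : ℝ)) := by
    exact (Real.summable_abs_int_rpow (b := 2) (by norm_num)).mul_left _ |>.congr fun n => by
      rw [Real.rpow_neg (abs_nonneg _), one_div]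
  refine Summable.of_norm_bounded_eventually hs ?_
  rw [Filter.eventually_cofinite]
  refine (Set.finite_singleton (0 : ℤ)).subset fun n hn => ?_
  by_contra h0
  apply hn
  have h1 := hC n
  rw [testCoeff_deriv hφ.deriv.deriv, testCoeff_deriv hφ.deriv, testCoeff_deriv hφ] at h1
  simp only [norm_mul, Complex.norm_I, one_mul, Complex.norm_intCast] at h1
  have h2 : (1 : ℝ) ≤ |(n : ℝ)| := by
    exact_mod_cast Int.one_le_abs h0
  have h3 : ((n.natAbs : ℕ) : ℝ) = |(n : ℝ)| := by rw [Nat.cast_natAbs]; simp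
  rw [h3, Real.norm_of_nonneg (by positivity), Real.rpow_two, mul_one_div,
    le_div_iff₀ (by positivity)]
  have h4 := norm_nonneg (testCoeff φ n)
  set t := |(n : ℝ)|
  nlinarith [mul_le_mul_of_nonneg_left h2 (by positivity : 0 ≤ ‖testCoeff φ n‖ * t ^ 2)]

/-- A smooth function on the plane restricts to a test function on the circle. -/
theorem periodicSmooth_comp_exp {F : ℂ → ℂ} (hF : ContDiff ℝ (⊤ : ℕ∞) F) :
    PeriodicSmooth fun θ : ℝ => F (Complex.exp ((θ : ℂ) * Complex.I)) := by
  refine ⟨hF.comp ((Complex.ofRealCLM.contDiff.mul contDiff_const).cexp), fun θ => ?_⟩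
  push_cast
  rw [add_mul, Complex.exp_periodic]

theorem testCoeff_mul_exp (φ : ℝ → ℂ) (k n : ℤ) :
    testCoeff (fun θ => φ θ * Complex.exp (k * (θ : ℂ) * Complex.I)) n =
      testCoeff φ (n - k) := by
  rw [testCoeff, testCoeff]
  congr 1
  refine intervalIntegral.integral_congr fun θ _ => ?_
  simp only [mul_assoc, ← Complex.exp_add]
  congr 2
  push_cast
  ring

theorem testCoeff_sub {φ χ : ℝ → ℂ} (hφ : Continuous φ) (hχ : Continuous χ) (n : ℤ) :
    testCoeff (fun θ => φ θ - χ θ) n = testCoeff φ n - testCoeff χ n := by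
  simp only [testCoeff, sub_mul, ← mul_sub]
  congr 1
  exact intervalIntegral.integral_sub (Continuous.intervalIntegrable (by fun_prop) _ _)
    (Continuous.intervalIntegrable (by fun_prop) _ _)

theorem testCoeff_const_mul (w : ℂ) (φ : ℝ → ℂ) (n : ℤ) :
    testCoeff (fun θ => w * φ θ) n = w * testCoeff φ n := by
  simp only [testCoeff, mul_assoc, intervalIntegral.integral_const_mul]
  ring

theorem testCoeff_one (n : ℤ) : testCoeff (fun _ => 1) n = if n = 0 then 1 else 0 := by
  split_ifs with h
  · subst h
    have := Complex.ofReal_ne_zero.2 Real.pi_ne_zero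
    simp [testCoeff]
    field_simp
  · have := testCoeff_deriv (φ := fun _ => 1) ⟨contDiff_const, fun _ => rfl⟩ n
    simpa [testCoeff, h] using this

/-- Multiplying the test function by a character shifts its pairing with a distribution. -/
theorem distAct_mul_exp (μ : CircleDistribution) (φ : ℝ → ℂ) (k : ℤ) :
    distAct μ (fun θ => φ θ * Complex.exp (k * (θ : ℂ) * Complex.I)) =
      ∑' n : ℤ, testCoeff φ n * μ.coeff (-(n + k)) := by
  rw [distAct, ← (Equiv.subLeft (-k)).tsum_eq]
  refine tsum_congr fun n => ?_
  rw [testCoeff_mul_exp, mul_comm, Equiv.subLeft_apply]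
  congr 2 <;> ring

/-- At a point `z` of the circle off the support of `μ`, the function `1` splits as
`a + (ζ - z) b` where `a` annihilates all the translates of `μ`. In terms of Fourier
coefficients: -/
theorem exists_coeff_of_notMem_distSupport {μ : CircleDistribution} {z : ℂ}
    (hz : z ∈ Metric.sphere (0 : ℂ) 1) (hzμ : z ∉ distSupport μ) :
    ∃ a b : ℤ → ℂ, (Summable fun n => ‖b n‖ * (n.natAbs + 1)) ∧
      (∀ k, ∑' n, a n * μ.coeff (-(n + k)) = 0) ∧
      ∀ n, b (n - 1) - z * b n = (if n = 0 then 1 else 0) - a n := by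
  obtain ⟨U, hU, hzU, hμU⟩ : ∃ U : Set ℂ, IsOpen U ∧ z ∈ U ∧ ∀ φ : ℝ → ℂ, PeriodicSmooth φ →
      (∀ θ : ℝ, Complex.exp ((θ : ℂ) * Complex.I) ∉ U → φ θ = 0) → distAct μ φ = 0 := by
    by_contra! h
    exact hzμ ⟨hz, h⟩
  obtain ⟨ε, hε, hεU⟩ := Metric.isOpen_iff.1 hU z hzU
  let f : ContDiffBump z := ⟨ε / 2, ε, by positivity, by linarith⟩
  have hf : ContDiff ℝ (⊤ : ℕ∞) fun ζ => (f ζ : ℂ) := Complex.ofRealCLM.contDiff.comp f.contDiff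
  have hG : ContDiff ℝ (⊤ : ℕ∞) fun ζ => (1 - (f ζ : ℂ)) / (ζ - z) := by
    refine contDiff_iff_contDiffAt.2 fun ζ => ?_
    rcases eq_or_ne ζ z with rfl | h
    · refine (contDiffAt_const (c := (0 : ℂ))).congr_of_eventuallyEq ?_
      filter_upwards [f.eventuallyEq_one] with x hx
      simp [hx]
    · simp only [div_eq_mul_inv]
      exact (contDiffAt_const.sub hf.contDiffAt).mul
        ((contDiffAt_id.sub contDiffAt_const).inv (sub_ne_zero.2 h))
  have hφ := periodicSmooth_comp_exp hf
  have hψ := periodicSmooth_comp_exp hG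
  set φ : ℝ → ℂ := fun θ => (f (Complex.exp ((θ : ℂ) * Complex.I)) : ℂ) with hφ_def
  set ψ : ℝ → ℂ := fun θ => (1 - (f (Complex.exp ((θ : ℂ) * Complex.I)) : ℂ)) /
    (Complex.exp ((θ : ℂ) * Complex.I) - z) with hψ_def
  refine ⟨testCoeff φ, testCoeff ψ, summable_testCoeff hψ, fun k => ?_, fun n => ?_⟩
  · rw [← distAct_mul_exp]
    refine hμU _ ⟨?_, fun θ => ?_⟩ fun θ hθ => ?_
    · exact hφ.1.mul
        ((contDiff_const.mul Complex.ofRealCLM.contDiff).mul contDiff_const).cexp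
    · beta_reduce
      rw [hφ.2, Complex.exp_eq_exp_iff_exists_int.2 ⟨k, ?_⟩]
      push_cast
      ring
    · have : f (Complex.exp ((θ : ℂ) * Complex.I)) = 0 :=
        f.zero_of_le_dist (not_lt.1 fun h => hθ (hεU h))
      simp [hφ_def, this]
  · have hφc := hφ.1.continuous
    have hψc := hψ.1.continuous
    rw [← testCoeff_one, ← testCoeff_sub continuous_const hφc, ← testCoeff_mul_exp,
      ← testCoeff_const_mul, ← testCoeff_sub (by fun_prop) (by fun_prop)]
    congr 1
    ext θ
    rcases eq_or_ne (Complex.exp ((θ : ℂ) * Complex.I)) z with h | h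
    · have : f z = 1 := f.one_of_mem_closedBall (Metric.mem_closedBall_self f.rIn_pos.le)
      simp [hψ_def, hφ_def, h, this]
    · have := sub_ne_zero.2 h
      simp only [hψ_def, hφ_def, Int.cast_one, one_mul]
      field_simp

/-- An operator all of whose powers grow at most linearly has spectrum in the unit disk. -/
theorem norm_le_one_of_mem_spectrum {A : Type*} [NormedRing A] [NormedAlgebra ℂ A]
    [CompleteSpace A] {a : A} (ha : ∀ n : ℕ, ‖a ^ n‖ ≤ n + 1) {z : ℂ}
    (hz : z ∈ spectrum ℂ a) : ‖z‖ ≤ 1 := by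
  by_contra! h
  have hle : ∀ n : ℕ, 1 ≤ ‖(1 : A)‖ * ((n : ℝ) ^ 1 / ‖z‖ ^ n + 1 / ‖z‖ ^ n) := fun n => by
    have h1 := (spectrum.norm_le_norm_mul_of_mem (spectrum.pow_mem_pow a n hz)).trans
      (mul_le_mul_of_nonneg_right (ha n) (norm_nonneg _))
    rw [norm_pow] at h1
    rw [← add_div, mul_div_assoc', le_div_iff₀ (by positivity)]
    linarith
  have h1 := tendsto_pow_const_div_const_pow_of_one_lt 1 h
  have h2 := tendsto_pow_const_div_const_pow_of_one_lt 0 h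
  simp only [pow_zero] at h2
  have h3 := ((h1.add h2).const_mul ‖(1 : A)‖)
  have := ge_of_tendsto' h3 hle
  norm_num at this

/-- If an invertible element and its inverse have powers growing at most linearly, its spectrum
is in the unit circle. -/
theorem norm_eq_one_of_mem_spectrum {A : Type*} [NormedRing A] [NormedAlgebra ℂ A]
    [CompleteSpace A] {P : ℤ → A} (h0 : P 0 = 1) (hadd : ∀ j k, P (j + k) = P j * P k)
    (hP : ∀ n, ‖P n‖ ≤ n.natAbs + 1) {z : ℂ} (hz : z ∈ spectrum ℂ (P 1)) : ‖z‖ = 1 := by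
  have hpow : ∀ k (n : ℕ), P k ^ n = P (n * k) := fun k n => by
    induction n with
    | zero => simp [h0]
    | succ n ih => rw [pow_succ, ih, ← hadd]; push_cast; ring_nf
  let u : Aˣ := ⟨P 1, P (-1), by rw [← hadd]; simpa using h0, by rw [← hadd]; simpa using h0⟩
  refine le_antisymm (norm_le_one_of_mem_spectrum (fun n => ?_) hz) ?_
  · simpa [hpow] using hP n
  · have hz0 : z ≠ 0 := spectrum.ne_zero_of_mem_of_unit (a := u) hz
    have h1 : z⁻¹ ∈ spectrum ℂ (P (-1)) := by
      have := (spectrum.inv_mem_iff (r := Units.mk0 z hz0) (a := u)).1 hz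
      rwa [Units.val_inv_eq_inv_val, Units.val_mk0] at this
    have h2 := norm_le_one_of_mem_spectrum (fun n => by simpa [hpow] using hP (-n)) h1
    rw [norm_inv] at h2
    exact (inv_le_one₀ (norm_pos_iff.2 hz0)).1 h2

/-- The functional calculus for absolutely convergent Fourier series: the factorization
`1 - a = (ζ - z) b` passes to operators. -/
theorem exists_hasSum_one_sub {A : Type*} [NormedRing A] [NormedAlgebra ℂ A]
    [CompleteSpace A] {P : ℤ → A} (h0 : P 0 = 1) (hadd : ∀ j k, P (j + k) = P j * P k)
    (hP : ∀ n, ‖P n‖ ≤ n.natAbs + 1) {a b : ℤ → ℂ} {z : ℂ}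
    (hb : Summable fun n => ‖b n‖ * (n.natAbs + 1))
    (hab : ∀ n, b (n - 1) - z * b n = (if n = 0 then 1 else 0) - a n) :
    ∃ C : A, (∀ B, Commute (P 1) B → Commute C B) ∧
      HasSum (fun n => a n • P n) (1 - (P 1 - z • 1) * C) := by
  have hs : Summable fun n => b n • P n := Summable.of_norm_bounded hb fun n => by
    rw [norm_smul]
    gcongr
    exact hP n
  let u : Aˣ := ⟨P 1, P (-1), by rw [← hadd]; simpa using h0, by rw [← hadd]; simpa using h0⟩
  have hu : ∀ n : ℤ, ((u ^ n : Aˣ) : A) = P n := fun n => by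
    induction n using Int.induction_on with
    | zero => simp [h0]
    | succ n ih => rw [zpow_add_one, Units.val_mul, ih, hadd]
    | pred n ih => rw [zpow_sub_one, Units.val_mul, ih, sub_eq_add_neg, hadd]; rfl
  refine ⟨∑' n, b n • P n, fun B hB => ?_, ?_⟩
  · refine Commute.tsum_left _ fun n => Commute.smul_left ?_ _
    rw [← hu]
    exact Commute.units_zpow_left (u := u) hB n
  · have h1 : HasSum (fun n => b (n - 1) • P n) (P 1 * ∑' n, b n • P n) := by
      have := hs.hasSum.mul_left (P 1)
      rw [← (Equiv.subRight (1 : ℤ)).hasSum_iff] at this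
      refine this.congr_fun fun n => ?_
      simp only [Function.comp_apply, Equiv.subRight_apply, mul_smul_comm, ← hadd]
      congr 2
      ring
    have h2 : HasSum (fun n : ℤ => (if n = 0 then (1 : ℂ) else 0) • P n) 1 := by
      have := hasSum_single (f := fun n : ℤ => (if n = 0 then (1 : ℂ) else 0) • P n) 0
        fun n hn => by simp [hn]
      simpa [h0] using this
    have h3 := h2.sub (h1.sub (hs.hasSum.const_smul z))
    rw [sub_mul, smul_mul_assoc, one_mul]
    refine h3.congr_fun fun n => ?_
    rw [smul_smul, ← sub_smul, ← sub_smul, hab, sub_sub_cancel]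

/-- The subspace of those `x` killed by every operator that commutes with `V` and kills `d`. -/
def bicommutantHull {X : Type*} [NormedAddCommGroup X] [NormedSpace ℂ X] (V : X →L[ℂ] X)
    (d : X) : Submodule ℂ X :=
  ⨅ B : {B : X →L[ℂ] X // Commute V B ∧ B d = 0}, LinearMap.ker (B : X →L[ℂ] X).toLinearMap

theorem mem_bicommutantHull {X : Type*} [NormedAddCommGroup X] [NormedSpace ℂ X]
    {V : X →L[ℂ] X} {d x : X} :
    x ∈ bicommutantHull V d ↔ ∀ B : X →L[ℂ] X, Commute V B → B d = 0 → B x = 0 := by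
  simp [bicommutantHull, Submodule.mem_iInf]

theorem self_mem_bicommutantHull {X : Type*} [NormedAddCommGroup X] [NormedSpace ℂ X]
    (V : X →L[ℂ] X) (d : X) : d ∈ bicommutantHull V d :=
  mem_bicommutantHull.2 fun _ _ h => h

theorem isClosed_bicommutantHull {X : Type*} [NormedAddCommGroup X] [NormedSpace ℂ X]
    (V : X →L[ℂ] X) (d : X) : IsClosed (bicommutantHull V d : Set X) := by
  rw [bicommutantHull, Submodule.coe_iInf]
  exact isClosed_iInter fun B => B.1.isClosed_ker

theorem map_mem_bicommutantHull {X : Type*} [NormedAddCommGroup X] [NormedSpace ℂ X]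
    {V C : X →L[ℂ] X} (hC : ∀ B, Commute V B → Commute C B) {d x : X}
    (hx : x ∈ bicommutantHull V d) : C x ∈ bicommutantHull V d := by
  refine mem_bicommutantHull.2 fun B hB hd => ?_
  have : B (C x) = C (B x) := DFunLike.congr_fun (hC B hB).symm.eq x
  rw [this, mem_bicommutantHull.1 hx B hB hd, map_zero]

/-- If `C` is in the bicommutant of `V` and inverts `V - z` at `d`, then `z` is outside the
spectrum of the restriction of `V` to the hull of `d`. -/
theorem notMem_spectrum_restrict {X : Type*} [NormedAddCommGroup X] [NormedSpace ℂ X]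
    {V C : X →L[ℂ] X} {d : X} {z : ℂ} (hV : ∀ x ∈ bicommutantHull V d, V x ∈ bicommutantHull V d)
    (hC : ∀ B, Commute V B → Commute C B) (hd : (1 - (V - z • 1) * C) d = 0) :
    z ∉ spectrum ℂ (V.restrict hV) := by
  have hVC : Commute C V := hC V (Commute.refl V)
  have hcom : Commute V (1 - (V - z • 1) * C) :=
    (Commute.one_right _).sub_right (((Commute.refl V).sub_right
      ((Commute.one_right V).smul_right z)).mul_right hVC.symm)
  have hinv : ∀ x ∈ bicommutantHull V d, V (C x) - z • C x = x := fun x hx => by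
    have := mem_bicommutantHull.1 hx _ hcom hd
    simpa [sub_eq_zero, eq_comm (a := x)] using this
  have hinv' : ∀ x ∈ bicommutantHull V d, C (V x) - z • C x = x := fun x hx => by
    have h : C (V x) = V (C x) := DFunLike.congr_fun hVC.eq x
    rw [h, hinv x hx]
  rw [spectrum.notMem_iff, ← IsUnit.neg_iff, neg_sub]
  refine ⟨⟨_, C.restrict fun x hx => map_mem_bicommutantHull hC hx, ?_, ?_⟩, rfl⟩
  · ext x
    simpa [Algebra.algebraMap_eq_smul_one] using hinv x x.2
  · ext x
    simpa [Algebra.algebraMap_eq_smul_one] using hinv' x x.2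

/-- The group of weighted shifts on `ℓ^∞(ℤ)` attached to a weight `w`. -/
theorem exists_weightedShift {w c : ℤ → ℝ} (hw : ∀ n, 0 < w n)
    (hc : ∀ k n, w n ≤ c k * w (n + k)) :
    ∃ P : ℤ → (BoundedContinuousFunction ℤ ℂ →L[ℂ] BoundedContinuousFunction ℤ ℂ),
      (∀ k y n, P k y n = (w n / w (n + k) : ℝ) * y (n + k)) ∧ ∀ k, ‖P k‖ ≤ c k := by
  have hc0 : ∀ k, 0 ≤ c k := fun k =>
    le_of_lt (pos_of_mul_pos_left ((hw 0).trans_le (hc k 0)) (hw _).le)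
  have hle : ∀ k (y : BoundedContinuousFunction ℤ ℂ) n,
      ‖((w n / w (n + k) : ℝ) : ℂ) * y (n + k)‖ ≤ c k * ‖y‖ := fun k y n => by
    have h1 : w n / w (n + k) ≤ c k := (div_le_iff₀ (hw _)).2 (hc k n)
    have h2 := (div_pos (hw n) (hw (n + k))).le
    rw [norm_mul, Complex.norm_real, Real.norm_of_nonneg h2]
    exact mul_le_mul h1 (y.norm_coe_le_norm _) (norm_nonneg _) (hc0 k)
  refine ⟨fun k => LinearMap.mkContinuous
    { toFun := fun y => BoundedContinuousFunction.ofNormedAddCommGroupDiscrete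
        (fun n => ((w n / w (n + k) : ℝ) : ℂ) * y (n + k)) (c k * ‖y‖) (hle k y)
      map_add' := fun x y => by ext n; simp [mul_add]
      map_smul' := fun r y => by ext n; simp [mul_left_comm] } (c k) fun y => ?_,
    fun k y n => rfl, fun k => LinearMap.mkContinuous_norm_le _ (hc0 k) _⟩
  exact (BoundedContinuousFunction.norm_le (mul_nonneg (hc0 k) (norm_nonneg _))).2 (hle k y)

/-- A sequence tending to zero remains bounded after multiplication by a weight which grows
slowly on the right. -/
theorem exists_bound_weight_mul {W : ℕ → ℝ} {c : ℤ → ℂ} (hW0 : W 0 = 1)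
    (hc : Tendsto c cofinite (nhds 0)) (hW : ∀ᶠ n : ℕ in atTop, W n * ‖c (-n)‖ ≤ 1) :
    ∃ C : ℝ, ∀ n : ℤ, W n.toNat * ‖c (-n)‖ ≤ C := by
  have hneg : Tendsto (fun n : ℤ => ‖c (-n)‖) cofinite (nhds 0) := by
    simpa using (hc.comp neg_injective.tendsto_cofinite).norm
  have hev : ∀ᶠ n : ℤ in cofinite, W n.toNat * ‖c (-n)‖ ≤ 1 := by
    have h1 : ∀ᶠ n : ℤ in cofinite, ‖c (-n)‖ ≤ 1 := hneg.eventually_le_const one_pos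
    rw [Int.cofinite_eq, eventually_sup] at h1 ⊢
    refine ⟨?_, ?_⟩
    · filter_upwards [h1.1, eventually_le_atBot (0 : ℤ)] with n hn hn0
      rwa [Int.toNat_of_nonpos hn0, hW0, one_mul]
    · obtain ⟨N, hN⟩ := eventually_atTop.1 hW
      filter_upwards [eventually_ge_atTop (N : ℤ)] with n hn
      have := hN n.toNat (by omega)
      rwa [Int.toNat_of_nonneg (by omega)] at this
  obtain ⟨C, hC⟩ := ((eventually_cofinite.1 hev).image
    fun n : ℤ => W n.toNat * ‖c (-n)‖).bddAbove
  refine ⟨max C 1, fun n => ?_⟩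
  by_cases h : W n.toNat * ‖c (-n)‖ ≤ 1
  · exact le_max_of_le_right h
  · exact le_max_of_le_left (hC ⟨n, h, rfl⟩)

/-- A group `P` of operators of linear growth, restricted to the hull of a vector `d`, is generated
by a contraction with spectrum in `E`, provided that enough Fourier series annihilate `d`. -/
theorem exists_banachContraction {X : Type} [NormedAddCommGroup X] [NormedSpace ℂ X]
    [CompleteSpace X] {P : ℤ → (X →L[ℂ] X)} {d : X} {E : Set ℂ} (h0 : P 0 = 1)
    (hadd : ∀ j k, P (j + k) = P j * P k) (hP : ∀ n, ‖P n‖ ≤ n.natAbs + 1) (h1 : ‖P 1‖ ≤ 1)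
    (hE : ∀ z ∈ Metric.sphere (0 : ℂ) 1, z ∉ E → ∃ a b : ℤ → ℂ,
      (Summable fun n => ‖b n‖ * (n.natAbs + 1)) ∧
      (∀ n, b (n - 1) - z * b n = (if n = 0 then 1 else 0) - a n) ∧
      ∀ y, HasSum (fun n => a n • P n d) y → y = 0) :
    ∃ B : BanachContraction, spectrum ℂ B.T ⊆ E ∧
      ∀ n : ℕ, ‖B.Tinv ^ n‖ ≤ ‖P (-n)‖ ∧ ‖P (-n) d‖ ≤ ‖B.Tinv ^ n‖ * ‖d‖ := by
  have hinv : P 1 * P (-1) = 1 ∧ P (-1) * P 1 = 1 := by simp [← hadd, h0]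
  have hcomm : ∀ B, Commute (P 1) B → Commute (P (-1)) B := fun B hB =>
    Commute.units_inv_left (u := ⟨P 1, P (-1), hinv.1, hinv.2⟩) hB
  have hP1 : ∀ x ∈ bicommutantHull (P 1) d, P 1 x ∈ bicommutantHull (P 1) d :=
    fun x hx => map_mem_bicommutantHull (fun _ h => h) hx
  have hP1' : ∀ x ∈ bicommutantHull (P 1) d, P (-1) x ∈ bicommutantHull (P 1) d :=
    fun x hx => map_mem_bicommutantHull hcomm hx
  have hpow : ∀ (n : ℕ) (x : bicommutantHull (P 1) d),
      (((P (-1)).restrict hP1' ^ n) x : X) = P (-n) x := by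
    intro n x
    induction n with
    | zero => simp [h0]
    | succ n ih =>
      rw [pow_succ', mul_apply_eq_comp, ContinuousLinearMap.coe_restrict_apply, ih,
        ← mul_apply_eq_comp, ← hadd]
      push_cast
      ring_nf
  have hspec : spectrum ℂ ((P 1).restrict hP1) ⊆ E := by
    intro z hz
    by_contra hzE
    by_cases hzP : z ∈ spectrum ℂ (P 1)
    · obtain ⟨a, b, hb, habz, hab⟩ := hE z
        (mem_sphere_zero_iff_norm.2 (norm_eq_one_of_mem_spectrum h0 hadd hP hzP)) hzE
      obtain ⟨C, hC, hsum⟩ := exists_hasSum_one_sub h0 hadd hP hb habz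
      exact notMem_spectrum_restrict hP1 hC
        (hab _ (hsum.mapL (ContinuousLinearMap.apply ℂ X d))) hz
    · rw [spectrum.notMem_iff, ← IsUnit.neg_iff, neg_sub, Algebra.algebraMap_eq_smul_one] at hzP
      obtain ⟨u, hu⟩ := hzP
      refine notMem_spectrum_restrict hP1 (C := (u⁻¹ : Units _)) (fun B hB => ?_) ?_ hz
      · refine Commute.units_inv_left ?_
        rw [hu]
        exact hB.sub_left ((Commute.one_left B).smul_left z)
      · rw [← hu]
        simp
  have : CompleteSpace (bicommutantHull (P 1) d) :=
    (isClosed_bicommutantHull _ _).completeSpace_coe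
  refine ⟨{ X := bicommutantHull (P 1) d
            T := (P 1).restrict hP1
            Tinv := (P (-1)).restrict hP1'
            norm_le := ContinuousLinearMap.opNorm_le_bound _ zero_le_one fun x =>
              (P 1).le_of_opNorm_le h1 x
            mul_inv := by
              ext x
              exact DFunLike.congr_fun hinv.1 (x : X)
            inv_mul := by
              ext x
              exact DFunLike.congr_fun hinv.2 (x : X) }, hspec, fun n => ⟨?_, ?_⟩⟩
  · refine ContinuousLinearMap.opNorm_le_bound _ (norm_nonneg _) fun x => ?_
    rw [Submodule.coe_norm, hpow]
    exact (P (-n)).le_opNorm x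
  · have h := ((P (-1)).restrict hP1' ^ n).le_opNorm ⟨d, self_mem_bicommutantHull _ _⟩
    rwa [Submodule.coe_norm, hpow] at h

/-- If `E` is a set of multiplicity, then for every sequence `ω_n → ∞`
there is an invertible contraction `T` on a Banach space with `Sp T ⊆ E` such that
`‖T^{-n}‖ → ∞` while `‖T^{-n}‖ ≤ ω_n` for all large `n`. -/
theorem stmt_17 (E : Set ℂ) (hE : IsMSet E) :
    ∀ ω : ℕ → ℝ, Filter.Tendsto ω Filter.atTop Filter.atTop →
      ∃ B : BanachContraction, spectrum ℂ B.T ⊆ E ∧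
        Filter.Tendsto (fun n : ℕ => ‖B.Tinv ^ n‖) Filter.atTop Filter.atTop ∧
        ∀ᶠ n in Filter.atTop, ‖B.Tinv ^ n‖ ≤ ω n := by
  intro ω hω
  obtain ⟨-, -, μ, hμ0, hμE, hμ⟩ := hE
  have hμneg : Tendsto (fun n : ℕ => ‖μ.coeff (-n)‖) atTop (nhds 0) := by
    have hinj : Function.Injective fun n : ℕ => (-n : ℤ) :=
      neg_injective.comp Nat.cast_injective
    simpa [Function.comp_def, Nat.cofinite_eq_atTop] using
      (hμ.comp hinj.tendsto_cofinite).norm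
  have hΩ : Tendsto (fun n : ℕ => min (ω n) (‖μ.coeff (-n)‖ + 1 / ((n : ℝ) + 1))⁻¹)
      atTop atTop := by
    suffices hinv : Tendsto (fun n : ℕ => (‖μ.coeff (-n)‖ + 1 / ((n : ℝ) + 1))⁻¹) atTop atTop from
      tendsto_atTop.2 fun b => (hω.eventually_ge_atTop b).mp
        ((hinv.eventually_ge_atTop b).mono fun n h h' => le_min h' h)
    refine tendsto_inv_nhdsGT_zero.comp
      (tendsto_nhdsWithin_iff.2 ⟨?_, Eventually.of_forall fun n => ?_⟩)
    · simpa using hμneg.add tendsto_one_div_add_atTop_nhds_zero_nat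
    · rw [mem_Ioi]
      positivity
  obtain ⟨W, hW1, hWmono, hWmul, hWtop, hWle, hWΩ⟩ := exists_submultiplicative_weight_le hΩ
  have hW0 : W 0 = 1 := le_antisymm (by simpa using hWle 0) (hW1 0)
  have hWpos : ∀ n, 0 < W n := fun n => one_pos.trans_le (hW1 n)
  obtain ⟨P, hPapply, hPnorm⟩ := exists_weightedShift (w := fun n => W n.toNat)
    (c := fun k => W (-k).toNat) (fun n => hWpos _) fun k n =>
      (hWmono (by omega)).trans (hWmul _ _)
  obtain ⟨K, hK⟩ := exists_bound_weight_mul hW0 hμ (by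
    filter_upwards [hWΩ] with n hn
    have h := (hn.trans (min_le_right _ _))
    rw [← one_div, le_div_iff₀ (by positivity)] at h
    refine le_trans ?_ h
    have := (hWpos n).le
    gcongr
    exact le_add_of_nonneg_right (by positivity))
  let d : BoundedContinuousFunction ℤ ℂ :=
    BoundedContinuousFunction.ofNormedAddCommGroupDiscrete
      (fun n => (W n.toNat : ℂ) * μ.coeff (-n)) K fun n => by
        rw [norm_mul, Complex.norm_real, Real.norm_of_nonneg (hWpos _).le]
        exact hK n
  have hd : ∀ n, d n = (W n.toNat : ℂ) * μ.coeff (-n) := fun n => rfl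
  have hWne : ∀ n, (W n : ℂ) ≠ 0 := fun n => Complex.ofReal_ne_zero.2 (hWpos n).ne'
  have hPd : ∀ k n, P k d n = W n.toNat * μ.coeff (-(n + k)) := fun k n => by
    have := hWne (n + k).toNat
    rw [hPapply, hd]
    push_cast
    field_simp
  have hP0 : P 0 = 1 := by
    ext y n
    rw [hPapply]
    simp [(hWpos n.toNat).ne']
  have hPadd : ∀ j k, P (j + k) = P j * P k := fun j k => by
    ext y n
    have := hWne (n + j).toNat
    rw [mul_apply_eq_comp, hPapply, hPapply, hPapply, add_assoc]
    push_cast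
    field_simp
  have hPlin : ∀ n, ‖P n‖ ≤ n.natAbs + 1 := fun n =>
    ((hPnorm n).trans (hWmono (by omega))).trans (hWle n.natAbs)
  obtain ⟨B, hBE, hB⟩ := exists_banachContraction (d := d) (E := E) hP0 hPadd hPlin
    (by simpa [hW0] using hPnorm 1) fun z hz hzE => by
      obtain ⟨a, b, hb, hab, habz⟩ := exists_coeff_of_notMem_distSupport hz fun h => hzE (hμE h)
      refine ⟨a, b, hb, habz, fun y hy => ?_⟩
      ext k
      have h1 := hy.mapL (BoundedContinuousFunction.evalCLM ℂ k)
      have h2 : ∑' n, a n * (W k.toNat * μ.coeff (-(n + k))) = 0 := by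
        simp only [mul_left_comm (a _), tsum_mul_left, hab, mul_zero]
      refine h1.tsum_eq.symm.trans (Eq.trans (tsum_congr fun n => ?_) h2)
      simp [hPd, add_comm k n]
  refine ⟨B, hBE, ?_, ?_⟩
  · obtain ⟨m, hm⟩ : ∃ m, μ.coeff m ≠ 0 := Function.ne_iff.1 hμ0
    have hd0 : 0 < ‖d‖ := by
      refine norm_pos_iff.2 fun h => ?_
      have := hd (-m)
      simp [h, hm, (hWpos _).ne'] at this
    have hlow : ∀ n : ℕ, W (n - m).toNat * ‖μ.coeff m‖ / ‖d‖ ≤ ‖B.Tinv ^ n‖ := fun n => by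
      rw [div_le_iff₀ hd0]
      refine le_trans ?_ (hB n).2
      have h2 := (P (-n) d).norm_coe_le_norm (n - m)
      rw [hPd, norm_mul, Complex.norm_real, Real.norm_of_nonneg (hWpos _).le] at h2
      simpa using h2
    refine tendsto_atTop_mono hlow ?_
    have h1 : Tendsto (fun n : ℕ => ((n : ℤ) - m).toNat) atTop atTop :=
      tendsto_atTop_atTop.2 fun b => ⟨b + m.natAbs, fun n hn => by omega⟩
    exact ((hWtop.comp h1).atTop_mul_const (norm_pos_iff.2 hm)).atTop_div_const hd0
  · filter_upwards [hWΩ] with n hn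
    exact (hB n).1.trans (le_trans (by simpa using hPnorm (-n)) (hn.trans (min_le_left _ _)))
end
end
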